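/- For every integer r ≥ 1, as N → ∞ one has N̄_r^+(N) ~ γ_r · N^{r/2 − 1} · e^{π√N}, where γ_r = r! · η(r) · π^{−r} · 2^{r−3} (so for r ≥ 2, γ_r = r! ζ(r)(1 − 2^{1−r}) π^{−r} 2^{r−3}); that is, N̄_r^+(N) / (γ_r N^{r/2−1} e^{π√N}) → 1 as N → ∞. -/

import Mathlib

open scoped BigOperators
open Filter MeasureTheory

/-- An overpartition of `n`: a partition of `n` in which the first occurrence of
each part size may be overlined.  We encode it as a finite set of (distinct)
overlined parts together with a multiset of non-overlined parts, all positive,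
with total sum `n`. -/
structure Overpartition (n : ℕ) where
  overlined : Finset ℕ
  nonoverlined : Multiset ℕ
  overlined_pos : ∀ i ∈ overlined, 0 < i
  nonoverlined_pos : ∀ i ∈ nonoverlined, 0 < i
  total : (overlined.sum id) + nonoverlined.sum = n

namespace Overpartition

/-- The multiset of all parts of an overpartition. -/
def parts {n : ℕ} (p : Overpartition n) : Multiset ℕ := p.overlined.val + p.nonoverlined

/-- Dyson's rank of an overpartition: largest part minus number of parts. -/
def rank {n : ℕ} (p : Overpartition n) : ℤ :=
  (p.parts.sup : ℤ) - (Multiset.card p.parts : ℤ)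

end Overpartition

/-- The crank of a partition (given as a multiset of positive parts):
the largest part if there are no 1's, and otherwise `μ(λ) - o(λ)` where `o(λ)`
is the number of 1's and `μ(λ)` is the number of parts larger than `o(λ)`. -/
def multisetCrank (s : Multiset ℕ) : ℤ :=
  if s.count 1 = 0 then (s.sup : ℤ)
  else ((s.filter (fun part => s.count 1 < part)).card : ℤ) - (s.count 1 : ℤ)

/-- The first residual crank of an overpartition: the crank of the subpartition
consisting of the non-overlined parts. -/
def Overpartition.crank {n : ℕ} (p : Overpartition n) : ℤ := multisetCrank p.nonoverlined

/-- `Mbar m n` is the number of overpartitions of `n` with first residual crank `m`. -/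
noncomputable def Mbar (m : ℤ) (n : ℕ) : ℕ :=
  Nat.card {p : Overpartition n // p.crank = m}

/-- `Nbar m n` is the number of overpartitions of `n` with Dyson rank `m`. -/
noncomputable def Nbar (m : ℤ) (n : ℕ) : ℕ :=
  Nat.card {p : Overpartition n // p.rank = m}

/-- The `r`-th positive crank moment `M̄_r^+(N) = Σ_{m ≥ 1} m^r M̄(m,N)`. -/
noncomputable def Mplus (r N : ℕ) : ℝ :=
  ∑' m : ℕ, ((m : ℝ) + 1) ^ r * (Mbar ((m : ℤ) + 1) N : ℝ)

/-- The `r`-th positive rank moment `N̄_r^+(N) = Σ_{m ≥ 1} m^r N̄(m,N)`. -/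
noncomputable def Nplus (r N : ℕ) : ℝ :=
  ∑' m : ℕ, ((m : ℝ) + 1) ^ r * (Nbar ((m : ℤ) + 1) N : ℝ)

/-- Positive symmetrized crank moment `μ̄_r^+(n) = Σ_{m ≥ 1} C(m + ⌊(r-1)/2⌋, r) M̄(m,n)`. -/
noncomputable def mubar (r n : ℕ) : ℝ :=
  ∑' m : ℕ, (Nat.choose (m + 1 + (r - 1) / 2) r : ℝ) * (Mbar ((m : ℤ) + 1) n : ℝ)

/-- Positive symmetrized rank moment `η̄_r^+(n) = Σ_{m ≥ 1} C(m + ⌊(r-1)/2⌋, r) N̄(m,n)`. -/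
noncomputable def etabar (r n : ℕ) : ℝ :=
  ∑' m : ℕ, (Nat.choose (m + 1 + (r - 1) / 2) r : ℝ) * (Nbar ((m : ℤ) + 1) n : ℝ)

/-- The Dirichlet eta function at positive integers:
`η(1) = log 2` and `η(r) = (1 - 2^{1-r}) ζ(r)` for `r ≥ 2`. -/
noncomputable def dirichletEtaNat (r : ℕ) : ℝ :=
  if r = 1 then Real.log 2 else (1 - 2 ^ (1 - (r : ℝ))) * (riemannZeta r).re

/-- The infinite Pochhammer symbol `(a; q)_∞ = Π_{j ≥ 0} (1 - a q^j)`. -/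
noncomputable def poch (a q : ℂ) : ℂ := ∏' j : ℕ, (1 - a * q ^ j)

/-- The (integral) exponent `n²/2 + (r/2 + ρ_C(r)) n`, where `ρ_C(r) = 0` for odd `r`
and `1/2` for even `r`. -/
def eC (r n : ℕ) : ℕ := (n * n + r * n + (if r % 2 = 0 then n else 0)) / 2

/-- The (integral) exponent `n² + (r/2 + ρ_R(r)) n`, where `ρ_R(r) = 1/2` for odd `r`
and `1` for even `r`. -/
def eR (r n : ℕ) : ℕ := (2 * n * n + r * n + (if r % 2 = 1 then n else 2 * n)) / 2

/-- `S_r(q) = Σ_{n ≥ 1} (-1)^{n+1} q^{n²/2 + (r/2 + ρ_C(r)) n} / (1 - q^n)^r`. -/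
noncomputable def Sr (r : ℕ) (q : ℂ) : ℂ :=
  ∑' n : ℕ, (-1 : ℂ) ^ n * q ^ eC r (n + 1) / (1 - q ^ (n + 1)) ^ r

/-- `S̃_r(q) = Σ_{n ≥ 1} (-1)^{n+1} q^{n² + (r/2 + ρ_R(r)) n} / ((1 - q^n)^r (1 + q^n))`. -/
noncomputable def Str (r : ℕ) (q : ℂ) : ℂ :=
  ∑' n : ℕ, (-1 : ℂ) ^ n * q ^ eR r (n + 1) / ((1 - q ^ (n + 1)) ^ r * (1 + q ^ (n + 1)))

/-- `SC_r(q) = ((-q;q)_∞/(q;q)_∞) S_r(q)`, the generating function of the positive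
symmetrized crank moments. -/
noncomputable def SCr (r : ℕ) (q : ℂ) : ℂ := (poch (-q) q / poch q q) * Sr r q

/-- `SR_r(q) = 2 ((-q;q)_∞/(q;q)_∞) S̃_r(q)`, the generating function of the positive
symmetrized rank moments. -/
noncomputable def SRr (r : ℕ) (q : ℂ) : ℂ := 2 * (poch (-q) q / poch q q) * Str r q

/-- `c_r = ζ(r) (1 - 2^{1-r})`. -/
noncomputable def cconst (r : ℕ) : ℂ := riemannZeta r * (1 - 2 ^ (1 - (r : ℂ)))

/-- `d_r = -(ζ(r-2)(1-2^{3-r})/2 + ρ_C(r) ζ(r-1)(1-2^{1-r}))`. -/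
noncomputable def dconst (r : ℕ) : ℂ :=
  -(riemannZeta ((r : ℂ) - 2) * (1 - 2 ^ (3 - (r : ℂ))) / 2 +
    (if r % 2 = 0 then (1 : ℂ) / 2 else 0) * riemannZeta ((r : ℂ) - 1) * (1 - 2 ^ (1 - (r : ℂ))))

/-- `d'_r = -(ζ(r-2)(1-2^{3-r}) + (ρ_R(r)/2) ζ(r-1)(1-2^{1-r}))`. -/
noncomputable def dconst' (r : ℕ) : ℂ :=
  -(riemannZeta ((r : ℂ) - 2) * (1 - 2 ^ (3 - (r : ℂ))) +
    (if r % 2 = 1 then (1 : ℂ) / 4 else (1 : ℂ) / 2) * riemannZeta ((r : ℂ) - 1) *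
      (1 - 2 ^ (1 - (r : ℂ))))

/-- The modified Bessel function of the first kind,
`I_s(x) = Σ_{k ≥ 0} (x/2)^{2k+s} / (k! Γ(k+s+1))`. -/
noncomputable def besselI (s x : ℝ) : ℝ :=
  ∑' k : ℕ, (x / 2) ^ (2 * (k : ℝ) + s) / ((k.factorial : ℝ) * Real.Gamma ((k : ℝ) + s + 1))

/-- The point `τ = x + i y` in the upper half plane. -/
noncomputable def mkTau (x y : ℝ) : ℂ := (x : ℂ) + (y : ℂ) * Complex.I

open scoped BigOperators
open Filter MeasureTheory

namespace RankAux

/-- Pairs (overlined parts, non-overlined parts). -/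
abbrev OP := Finset ℕ × Multiset ℕ

/-- Largest part. -/
def mx (p : OP) : ℕ := (p.1.val + p.2).sup
/-- Number of parts. -/
def cd (p : OP) : ℕ := p.1.card + Multiset.card p.2
/-- Sum of the parts. -/
def tot (p : OP) : ℕ := p.1.sum id + p.2.sum
/-- All parts are positive. -/
def valid (p : OP) : Prop := (∀ i ∈ p.1, 0 < i) ∧ (∀ i ∈ p.2, 0 < i)

lemma mx_le (p : OP) (L : ℕ) : mx p ≤ L ↔ (∀ i ∈ p.1, i ≤ L) ∧ (∀ i ∈ p.2, i ≤ L) := by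
  unfold mx
  rw [Multiset.sup_le]
  simp only [Multiset.mem_add, Finset.mem_val]
  constructor
  · intro h; exact ⟨fun i hi => h i (Or.inl hi), fun i hi => h i (Or.inr hi)⟩
  · rintro ⟨h1, h2⟩ i (hi | hi)
    · exact h1 i hi
    · exact h2 i hi

lemma multiset_card_le_sum (s : Multiset ℕ) (h : ∀ i ∈ s, 0 < i) : Multiset.card s ≤ s.sum := by
  have := Multiset.card_nsmul_le_sum (s := s) (a := 1) (fun x hx => h x hx)
  simpa using this

lemma cd_le_tot (p : OP) (h : valid p) : cd p ≤ tot p := by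
  unfold cd tot
  have h1 : p.1.card ≤ p.1.sum id := by
    have := Finset.card_nsmul_le_sum p.1 id 1 (fun x hx => h.1 x hx)
    simpa using this
  have h2 := multiset_card_le_sum p.2 h.2
  omega

lemma mx_le_tot (p : OP) : mx p ≤ tot p := by
  rw [mx_le]
  constructor
  · intro i hi
    have : id i ≤ p.1.sum id := Finset.single_le_sum (fun _ _ => Nat.zero_le _) hi
    unfold tot; simp only [id] at this ⊢; omega
  · intro i hi
    have := Multiset.single_le_sum (fun _ _ => Nat.zero_le _) i hi
    unfold tot; omega

lemma ov_finite (n : ℕ) : {p : OP | valid p ∧ tot p = n}.Finite := by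
  apply Set.Finite.subset (s := (((Finset.range (n+1)).powerset ×ˢ
    (Multiset.powerset (n • (Finset.range (n+1)).val)).toFinset : Finset OP) : Set OP))
    (Finset.finite_toSet _)
  rintro p ⟨hv, ht⟩
  have hm := mx_le_tot p
  rw [ht, mx_le] at hm
  have hc := cd_le_tot p hv
  simp only [Finset.coe_product, Set.mem_prod, Finset.mem_coe, Finset.mem_powerset,
    Multiset.mem_toFinset, Multiset.mem_powerset]
  constructor
  · intro i hi
    have := hm.1 i hi
    simp; omega
  · rw [Multiset.le_iff_count]
    intro i
    by_cases hi : i ∈ p.2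
    · have h1 := hm.2 i hi
      have h2 : Multiset.count i (Finset.range (n+1)).val = 1 := by
        apply Multiset.count_eq_one_of_mem (Finset.nodup _)
        simp; omega
      rw [Multiset.count_nsmul, h2]
      have h3 := Multiset.count_le_card i p.2
      unfold cd at hc
      omega
    · rw [Multiset.count_eq_zero_of_notMem hi]; exact Nat.zero_le _

/-- The finset of overpartitions of `n`. -/
noncomputable def ov (n : ℕ) : Finset OP := (ov_finite n).toFinset

lemma mem_ov (n : ℕ) (p : OP) : p ∈ ov n ↔ valid p ∧ tot p = n := by
  simp [ov]

open Classical in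
/-- Number of overpartitions of `n` with property `P`. -/
noncomputable def cnt (P : OP → Prop) (n : ℕ) : ℕ := ((ov n).filter P).card

lemma cnt_congr {P Q : OP → Prop} {n : ℕ} (h : ∀ p ∈ ov n, P p ↔ Q p) : cnt P n = cnt Q n := by
  classical
  unfold cnt
  congr 1
  apply Finset.filter_congr h

lemma cnt_mono {P Q : OP → Prop} {n : ℕ} (h : ∀ p ∈ ov n, P p → Q p) : cnt P n ≤ cnt Q n := by
  classical
  unfold cnt
  apply Finset.card_le_card
  intro p hp
  rw [Finset.mem_filter] at hp ⊢
  exact ⟨hp.1, h p hp.1 hp.2⟩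

lemma cnt_split (P Q : OP → Prop) (n : ℕ) :
    cnt P n = cnt (fun p => P p ∧ Q p) n + cnt (fun p => P p ∧ ¬ Q p) n := by
  classical
  unfold cnt
  rw [← Finset.card_filter_add_card_filter_not (s := (ov n).filter P) Q, Finset.filter_filter,
    Finset.filter_filter]
  congr!

lemma cnt_zero_of {P : OP → Prop} {n : ℕ} (h : ∀ p ∈ ov n, ¬ P p) : cnt P n = 0 := by
  classical
  unfold cnt
  rw [Finset.card_eq_zero, Finset.filter_eq_empty_iff]
  exact fun p hp => h p hp

lemma cnt_fiber (P : OP → Prop) (f : OP → ℕ) (n J : ℕ) (h : ∀ p ∈ ov n, P p → f p < J) :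
    cnt P n = ∑ j ∈ Finset.range J, cnt (fun p => P p ∧ f p = j) n := by
  classical
  unfold cnt
  rw [Finset.card_eq_sum_card_fiberwise (f := f) (t := Finset.range J)]
  · apply Finset.sum_congr rfl
    intro j _
    rw [Finset.filter_filter]
    congr!
  · intro p hp
    simp only [Finset.coe_filter, Set.mem_ofPred_eq] at hp
    simpa using h p hp.1 hp.2

/-- If `φ` maps overpartitions of `n` with `P` bijectively on those of `n + d` with `Q`. -/
lemma cnt_bij (P Q : OP → Prop) (n m : ℕ) (φ : OP → OP)
    (h1 : ∀ p ∈ ov n, P p → φ p ∈ ov m ∧ Q (φ p))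
    (h2 : ∀ p ∈ ov n, ∀ p' ∈ ov n, P p → P p' → φ p = φ p' → p = p')
    (h3 : ∀ q ∈ ov m, Q q → ∃ p ∈ ov n, P p ∧ φ p = q) : cnt P n = cnt Q m := by
  classical
  unfold cnt
  apply Finset.card_bij (fun p _ => φ p)
  · intro p hp
    rw [Finset.mem_filter] at hp ⊢
    exact h1 p hp.1 hp.2
  · intro p hp p' hp' h
    rw [Finset.mem_filter] at hp hp'
    exact h2 p hp.1 p' hp'.1 hp.2 hp'.2 h
  · intro q hq
    rw [Finset.mem_filter] at hq
    obtain ⟨p, hp, hP, rfl⟩ := h3 q hq.1 hq.2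
    exact ⟨p, by rw [Finset.mem_filter]; exact ⟨hp, hP⟩, rfl⟩

/-- adding a non-overlined part -/
lemma cnt_cons (P Q : OP → Prop) (n d : ℕ) (hd : 0 < d)
    (hPQ : ∀ s t, P (s, t) ↔ Q (s, d ::ₘ t)) :
    cnt P n = cnt (fun p => d ∈ p.2 ∧ Q p) (n + d) := by
  apply cnt_bij P _ n (n + d) (fun p => (p.1, d ::ₘ p.2))
  · rintro ⟨s, t⟩ hp hP
    rw [mem_ov] at hp ⊢
    refine ⟨⟨⟨hp.1.1, ?_⟩, ?_⟩, ?_, ?_⟩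
    · intro i hi
      rw [Multiset.mem_cons] at hi
      rcases hi with rfl | hi
      · exact hd
      · exact hp.1.2 i hi
    · have := hp.2
      simp [tot] at this ⊢; omega
    · simp
    · exact (hPQ s t).1 hP
  · rintro ⟨s, t⟩ _ ⟨s', t'⟩ _ _ _ h
    simpa using h
  · rintro ⟨s, t⟩ hq ⟨hd, hQ⟩
    obtain ⟨u, hu⟩ := Multiset.exists_cons_of_mem hd
    simp only at hu
    subst hu
    refine ⟨(s, u), ?_, (hPQ s u).2 hQ, rfl⟩
    rw [mem_ov] at hq ⊢
    refine ⟨⟨hq.1.1, fun i hi => hq.1.2 i (Multiset.mem_cons_of_mem hi)⟩, ?_⟩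
    have := hq.2
    simp [tot] at this ⊢; omega

/-- adding an overlined part -/
lemma cnt_insert (P Q : OP → Prop) (n d : ℕ) (hd : 0 < d)
    (hPd : ∀ p, P p → d ∉ p.1)
    (hPQ : ∀ s t, d ∉ s → (P (s, t) ↔ Q (insert d s, t))) :
    cnt P n = cnt (fun p => d ∈ p.1 ∧ Q p) (n + d) := by
  apply cnt_bij P _ n (n + d) (fun p => (insert d p.1, p.2))
  · rintro ⟨s, t⟩ hp hP
    have hds := hPd _ hP
    simp only at hds
    rw [mem_ov] at hp ⊢
    refine ⟨⟨⟨?_, hp.1.2⟩, ?_⟩, ?_, ?_⟩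
    · intro i hi
      rw [Finset.mem_insert] at hi
      rcases hi with rfl | hi
      · exact hd
      · exact hp.1.1 i hi
    · have := hp.2
      simp [tot, Finset.sum_insert hds] at this ⊢; omega
    · simp
    · exact (hPQ s t hds).1 hP
  · rintro ⟨s, t⟩ _ ⟨s', t'⟩ _ hP hP' h
    have h1 := hPd _ hP
    have h2 := hPd _ hP'
    simp only [Prod.mk.injEq] at h h1 h2 ⊢
    refine ⟨?_, h.2⟩
    rw [← Finset.erase_insert h1, h.1, Finset.erase_insert h2]
  · rintro ⟨s, t⟩ hq ⟨hds, hQ⟩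
    simp only at hds
    have hs : insert d (s.erase d) = s := Finset.insert_erase hds
    have hne : d ∉ s.erase d := Finset.notMem_erase d s
    refine ⟨(s.erase d, t), ?_, (hPQ _ t hne).2 (by rw [hs]; exact hQ), by simp [hs]⟩
    rw [mem_ov] at hq ⊢
    refine ⟨⟨fun i hi => hq.1.1 i (Finset.mem_of_mem_erase hi), hq.1.2⟩, ?_⟩
    have := hq.2
    rw [← hs] at this
    simp only [tot, Finset.sum_insert hne, id] at this ⊢; omega

/-- Coefficients: overpartitions of `n` in a box. -/
noncomputable def bc (k L n : ℕ) : ℕ := cnt (fun p => mx p ≤ L ∧ cd p ≤ k) n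

lemma bc_rec (k L n : ℕ) : bc (k+1) (L+1) (n + (L+1)) =
    bc (k+1) L (n + (L+1)) + (bc k (L+1) n + bc k L n) := by
  have e1 : bc k (L+1) n = cnt (fun p => (L+1) ∈ p.2 ∧ (mx p ≤ L + 1 ∧ cd p ≤ k + 1)) (n + (L+1)) := by
    apply cnt_cons
    · omega
    · intro s t
      simp only [mx_le, cd, Multiset.mem_cons, Multiset.card_cons]
      constructor
      · rintro ⟨⟨h1, h2⟩, h3⟩
        refine ⟨⟨h1, ?_⟩, by omega⟩
        rintro i (rfl | hi)
        · exact le_refl _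
        · exact h2 i hi
      · rintro ⟨⟨h1, h2⟩, h3⟩
        exact ⟨⟨h1, fun i hi => h2 i (Or.inr hi)⟩, by omega⟩
  have e2 : bc k L n = cnt (fun p => (L+1) ∈ p.1 ∧ ((L+1) ∉ p.2 ∧ mx p ≤ L + 1 ∧ cd p ≤ k + 1))
      (n + (L+1)) := by
    apply cnt_insert
    · omega
    · intro p hp h
      have := ((mx_le p L).1 hp.1).1 _ h
      omega
    · intro s t hs
      simp only [mx_le, cd, Finset.mem_insert, Finset.card_insert_of_notMem hs]
      constructor
      · rintro ⟨⟨h1, h2⟩, h3⟩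
        refine ⟨fun h => ?_, ⟨?_, ?_⟩, by omega⟩
        · have := h2 _ h; omega
        · rintro i (rfl | hi)
          · exact le_refl _
          · have := h1 i hi; omega
        · intro i hi; have := h2 i hi; omega
      · rintro ⟨h0, ⟨h1, h2⟩, h3⟩
        refine ⟨⟨?_, ?_⟩, by omega⟩
        · intro i hi
          have := h1 i (Or.inr hi)
          have : i ≠ L + 1 := fun h => hs (h ▸ hi)
          omega
        · intro i hi
          have := h2 i hi
          have : i ≠ L + 1 := fun h => h0 (h ▸ hi)
          omega
  rw [e1, e2]
  unfold bc
  rw [cnt_split (fun p => mx p ≤ L + 1 ∧ cd p ≤ k + 1) (fun p => mx p ≤ L)]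
  congr 1
  · apply cnt_congr
    intro p _
    constructor
    · rintro ⟨⟨a, b⟩, c⟩; exact ⟨c, b⟩
    · rintro ⟨a, b⟩; exact ⟨⟨by omega, b⟩, a⟩
  · rw [cnt_split _ (fun p => (L+1) ∈ p.2)]
    congr 1
    · apply cnt_congr
      intro p _
      constructor
      · rintro ⟨⟨a, b⟩, c⟩; exact ⟨c, a⟩
      · rintro ⟨a, b⟩
        refine ⟨⟨b, ?_⟩, a⟩
        intro h
        have := ((mx_le p L).1 h).2 _ a
        omega
    · apply cnt_congr
      intro p _
      constructor
      · rintro ⟨⟨a, b⟩, c⟩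
        refine ⟨?_, c, a⟩
        by_contra hn
        apply b
        rw [mx_le] at a ⊢
        refine ⟨fun i hi => ?_, fun i hi => ?_⟩
        · have := a.1.1 i hi
          have : i ≠ L + 1 := fun h => hn (h ▸ hi)
          omega
        · have := a.1.2 i hi
          have : i ≠ L + 1 := fun h => c (h ▸ hi)
          omega
      · rintro ⟨a, b, c⟩
        refine ⟨⟨c, ?_⟩, b⟩
        intro h
        have := ((mx_le p L).1 h).1 _ a
        omega

lemma bc_rec' (k L n : ℕ) (h : n ≤ L) : bc (k+1) (L+1) n = bc (k+1) L n := by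
  apply cnt_congr
  intro p hp
  have := mx_le_tot p
  rw [mem_ov] at hp
  constructor
  · rintro ⟨a, b⟩; exact ⟨by omega, b⟩
  · rintro ⟨a, b⟩; exact ⟨by omega, b⟩

lemma ov_zero : ov 0 = {((∅ : Finset ℕ), (0 : Multiset ℕ))} := by
  ext ⟨s, t⟩
  rw [mem_ov, Finset.mem_singleton]
  constructor
  · rintro ⟨hv, ht⟩
    have := cd_le_tot _ hv
    rw [ht] at this
    simp only [cd] at this
    have h1 : s.card = 0 := by omega
    have h2 : Multiset.card t = 0 := by omega
    rw [Finset.card_eq_zero] at h1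
    rw [Multiset.card_eq_zero] at h2
    simp [h1, h2]
  · intro h
    rw [Prod.mk.injEq] at h
    obtain ⟨rfl, rfl⟩ := h
    simp [valid, tot]

lemma cnt_at_zero (P : OP → Prop) (h : P (∅, 0)) : cnt P 0 = 1 := by
  classical
  unfold cnt
  rw [ov_zero, Finset.filter_singleton, if_pos h]; rfl

lemma cd_pos_of {n : ℕ} (hn : 0 < n) {p : OP} (hp : p ∈ ov n) : 0 < cd p := by
  rw [mem_ov] at hp
  by_contra h
  have h0 : cd p = 0 := by omega
  unfold cd at h0
  have h1 : p.1.card = 0 := by omega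
  have h2 : Multiset.card p.2 = 0 := by omega
  rw [Finset.card_eq_zero] at h1
  rw [Multiset.card_eq_zero] at h2
  have := hp.2
  simp [tot, h1, h2] at this
  omega

lemma mx_pos_of {n : ℕ} (hn : 0 < n) {p : OP} (hp : p ∈ ov n) : 0 < mx p := by
  have hc := cd_pos_of hn hp
  rw [mem_ov] at hp
  by_contra h
  have h0 : mx p ≤ 0 := by omega
  rw [mx_le] at h0
  unfold cd at hc
  rcases Nat.eq_zero_or_pos p.1.card with h1 | h1
  · have : 0 < Multiset.card p.2 := by omega
    obtain ⟨i, hi⟩ := Multiset.card_pos_iff_exists_mem.1 this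
    have := hp.1.2 i hi
    have := h0.2 i hi
    omega
  · obtain ⟨i, hi⟩ := Finset.card_pos.1 h1
    have := hp.1.1 i hi
    have := h0.1 i hi
    omega

lemma mx_empty : mx ((∅ : Finset ℕ), (0 : Multiset ℕ)) = 0 := by simp [mx]
lemma cd_empty : cd ((∅ : Finset ℕ), (0 : Multiset ℕ)) = 0 := by simp [cd]

lemma bc_zero_left (L n : ℕ) : bc 0 L n = if n = 0 then 1 else 0 := by
  split_ifs with h
  · subst h
    exact cnt_at_zero _ ⟨by rw [mx_empty]; omega, by rw [cd_empty]⟩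
  · apply cnt_zero_of
    intro p hp hP
    have := cd_pos_of (by omega) hp
    omega

lemma bc_zero_right (k n : ℕ) : bc k 0 n = if n = 0 then 1 else 0 := by
  split_ifs with h
  · subst h
    exact cnt_at_zero _ ⟨by rw [mx_empty], by rw [cd_empty]; omega⟩
  · apply cnt_zero_of
    intro p hp hP
    have := mx_pos_of (by omega) hp
    omega

open PowerSeries in
/-- Generating function of overpartitions in a box. -/
noncomputable def b (k L : ℕ) : PowerSeries ℤ := PowerSeries.mk (fun n => (bc k L n : ℤ))

lemma coeff_b (k L n : ℕ) : PowerSeries.coeff n (b k L) = (bc k L n : ℤ) := by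
  simp [b]

open PowerSeries in
lemma b_rec (k L : ℕ) : b (k+1) (L+1) = b (k+1) L + X^(L+1) * (b k (L+1) + b k L) := by
  ext n
  rw [map_add, coeff_X_pow_mul', map_add]
  simp only [coeff_b]
  split_ifs with h
  · obtain ⟨m, rfl⟩ := Nat.exists_eq_add_of_le' h
    rw [bc_rec, Nat.add_sub_cancel]
    push_cast; rfl
  · rw [bc_rec' _ _ _ (by omega)]; simp

lemma b_zero_left (L : ℕ) : b 0 L = 1 := by
  ext n
  rw [coeff_b, bc_zero_left, PowerSeries.coeff_one]; split_ifs <;> rfl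

lemma b_zero_right (L : ℕ) : b L 0 = 1 := by
  ext n
  rw [coeff_b, bc_zero_right, PowerSeries.coeff_one]; split_ifs <;> rfl

open PowerSeries in
lemma b_rec2 (k L : ℕ) : b (k+1) (L+1) = b k (L+1) + X^(k+1) * (b (k+1) L + b k L) := by
  induction k generalizing L with
  | zero =>
    induction L with
    | zero =>
      rw [b_rec]
      simp only [b_zero_left, b_zero_right]
    | succ L ih =>
      have h1 := b_rec 0 (L+1)
      have h2 := b_rec 0 L
      simp only [b_zero_left] at *
      linear_combination h1 - X * h2 + ih
  | succ k ihk =>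
    induction L with
    | zero =>
      have h1 := b_rec (k+1) 0
      have h2 := b_rec k 0
      have h3 := ihk 0
      simp only [b_zero_right] at *
      linear_combination h1 - h2 + X * h3
    | succ L ihL =>
      have h1 := b_rec (k+1) (L+1)
      have h2 := b_rec k (L+1)
      have h3 := b_rec (k+1) L
      have h4 := b_rec k L
      have h5 := ihk (L+1)
      have h6 := ihk L
      linear_combination h1 - h2 - X^(k+2) * h3 - X^(k+2) * h4 + ihL + X^(L+2) * h5 + X^(L+2) * h6

lemma b_symm (k L : ℕ) : b k L = b L k := by
  induction k generalizing L with
  | zero => rw [b_zero_left, b_zero_right]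
  | succ k ihk =>
    induction L with
    | zero => rw [b_zero_left, b_zero_right]
    | succ L ihL =>
      rw [b_rec, b_rec2 L k, ihL, ihk, ihk]

/-- Total number of overpartitions. -/
noncomputable def oc (n : ℕ) : ℕ := cnt (fun _ => True) n
/-- Number with rank at least `m`. -/
noncomputable def G (m n : ℕ) : ℕ := cnt (fun p => cd p + m ≤ mx p) n
/-- Number with rank at most `m`. -/
noncomputable def R (m n : ℕ) : ℕ := cnt (fun p => mx p ≤ cd p + m) n

lemma G_add_R (m n : ℕ) : R m n + G (m+1) n = oc n := by
  unfold oc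
  rw [cnt_split _ (fun p => mx p ≤ cd p + m)]
  congr 1
  · apply cnt_congr; intro p _; simp
  · apply cnt_congr; intro p _; simp; omega

lemma cnt_sub {P Q T : OP → Prop} {n : ℕ} (h : ∀ p ∈ ov n, (P p ↔ (Q p ∨ T p)))
    (h' : ∀ p ∈ ov n, Q p → ¬ T p) :
    (cnt Q n : ℤ) = cnt P n - cnt T n := by
  have h1 := cnt_split P T n
  have h2 : cnt (fun p => P p ∧ T p) n = cnt T n := by
    apply cnt_congr
    intro p hp
    have := h p hp
    tauto
  have h3 : cnt (fun p => P p ∧ ¬ T p) n = cnt Q n := by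
    apply cnt_congr
    intro p hp
    have := h p hp
    have := h' p hp
    tauto
  omega

open PowerSeries in
lemma G_eq (m n J : ℕ) (hn : 0 < n) (hJ : n ≤ J) :
    (G m n : ℤ) = ∑ j ∈ Finset.range J,
      coeff n (X^(m+j+1) * (b j (m+j+1) + b j (m+j)) : PowerSeries ℤ) := by
  unfold G
  rw [cnt_fiber _ (fun p => mx p - (m+1)) n J]
  · push_cast
    apply Finset.sum_congr rfl
    intro j _
    have h1 := b_rec j (m+j)
    have h2 : (X^(m+j+1) * (b j (m+j+1) + b j (m+j)) : PowerSeries ℤ)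
      = b (j+1) (m+j+1) - b (j+1) (m+j) := by rw [h1]; ring
    rw [h2, map_sub, coeff_b, coeff_b]
    apply cnt_sub
    · intro p hp
      have := mx_pos_of hn hp
      have := cd_pos_of hn hp
      omega
    · intro p hp
      have := cd_pos_of hn hp
      omega
  · intro p hp _
    have := mx_le_tot p
    have := mx_pos_of hn hp
    rw [mem_ov] at hp
    omega

open PowerSeries in
lemma R_eq (m n J : ℕ) (hJ : n ≤ J) :
    (R m n : ℤ) = coeff n (1 : PowerSeries ℤ) + ∑ j ∈ Finset.range J,
      coeff n (X^(j+1) * (b (j+1) (j+m) + b j (j+m)) : PowerSeries ℤ) := by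
  unfold R
  rw [cnt_fiber _ cd n (J+1), Finset.sum_range_succ']
  · push_cast
    rw [add_comm]
    congr 1
    · rw [← b_zero_left m, coeff_b]
      norm_cast
      apply cnt_congr
      intro p hp
      omega
    · apply Finset.sum_congr rfl
      intro j _
      have h1 := b_rec2 j (j+m)
      have h2 : (X^(j+1) * (b (j+1) (j+m) + b j (j+m)) : PowerSeries ℤ)
        = b (j+1) (j+m+1) - b j (j+m+1) := by rw [h1]; ring
      rw [h2, map_sub, coeff_b, coeff_b]
      apply cnt_sub
      · intro p hp
        omega
      · intro p hp
        omega
  · intro p hp _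
    rw [mem_ov] at hp
    have := cd_le_tot p hp.1
    omega

open PowerSeries in
/-- Dyson-type recursion. -/
lemma dyson (m n : ℕ) : G m (n+(m+1)) + G (m+1) (n+(m+1)) = R (m+2) n + R (m+1) n := by
  zify
  have hJ1 : n + (m+1) ≤ n + m + 2 := by omega
  have hJ2 : n + (m+1) ≤ n + m + 1 := by omega
  rw [G_eq m _ _ (by omega) hJ1, G_eq (m+1) _ _ (by omega) hJ2, R_eq (m+2) n (n+m+1) (by omega),
    R_eq (m+1) n (n+m+1) (by omega), Finset.sum_range_succ']
  have key : ∀ (e : ℕ) (f : PowerSeries ℤ),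
      coeff (n+(m+1)) (X^(m+1+e) * f) = coeff n (X^e * f) := by
    intro e f
    rw [pow_add, mul_assoc, mul_comm (X^(m+1)), coeff_mul_X_pow]
  have e0 : coeff (n+(m+1)) (X^(m+0+1) * (b 0 (m+0+1) + b 0 (m+0)) : PowerSeries ℤ)
      = coeff n (1 : PowerSeries ℤ) + coeff n (1 : PowerSeries ℤ) := by
    have := key 0 (b 0 (m+0+1) + b 0 (m+0))
    rw [show m+0+1 = m+1+0 by ring, this]
    simp [b_zero_left]
  rw [e0]
  have e1 : ∀ j, coeff (n+(m+1)) (X^(m+(j+1)+1) * (b (j+1) (m+(j+1)+1) + b (j+1) (m+(j+1))) : PowerSeries ℤ)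
     = coeff n (X^(j+1) * (b (j+1) (j+(m+2)) + b (j+1) (j+(m+1)))) := by
    intro j
    rw [← key]
    congr 2
    · congr 1; ring
    · congr 2 <;> ring
  have e2 : ∀ j, coeff (n+(m+1)) (X^(m+1+j+1) * (b j (m+1+j+1) + b j (m+1+j)) : PowerSeries ℤ)
     = coeff n (X^(j+1) * (b j (j+(m+2)) + b j (j+(m+1)))) := by
    intro j
    rw [← key]
    congr 2
    congr 2 <;> ring
  simp only [e1, e2]
  have : ∀ x1 x2 x3 x4 x5 : ℤ, x3 + x4 = x1 + x2 → x1 + (x5 + x5) + x2 = x5 + x3 + (x5 + x4) := by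
    intros; linarith
  apply this
  rw [← Finset.sum_add_distrib, ← Finset.sum_add_distrib]
  apply Finset.sum_congr rfl
  intro j _
  rw [← map_add, ← map_add]
  congr 1
  ring

lemma G_zero_of_le (m n : ℕ) (hn : 0 < n) (h : n ≤ m) : G m n = 0 := by
  apply cnt_zero_of
  intro p hp
  have := cd_pos_of hn hp
  have := mx_le_tot p
  rw [mem_ov] at hp
  omega

lemma G_anti (m n : ℕ) : G (m+1) n ≤ G m n := cnt_mono (fun p _ h => by omega)

lemma G_le_oc (m n : ℕ) : G m n ≤ oc n := cnt_mono (fun _ _ _ => trivial)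

lemma oc_zero : oc 0 = 1 := cnt_at_zero _ trivial

lemma dyson' (m n : ℕ) : G m (n+(m+1)) + G (m+1) (n+(m+1)) + (G (m+2) n + G (m+3) n) = 2 * oc n := by
  have := dyson m n
  have h1 := G_add_R (m+2) n
  have h2 := G_add_R (m+1) n
  have e : m+2+1 = m+3 := rfl
  have e' : m+1+1 = m+2 := rfl
  rw [e] at h1
  rw [e'] at h2
  omega

open PowerSeries in
/-- Symmetry of the rank, at the level needed. -/
lemma G_sym (n : ℕ) (hn : 0 < n) : G 0 n + G 1 n = oc n := by
  have h1 : G 1 n = cnt (fun p => mx p + 1 ≤ cd p) n := by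
    apply Nat.cast_injective (R := ℤ)
    unfold G
    rw [cnt_fiber (fun p => mx p + 1 ≤ cd p) (fun p => cd p - 2) n n,
      cnt_fiber (fun p => cd p + 1 ≤ mx p) (fun p => mx p - 2) n n]
    · push_cast
      apply Finset.sum_congr rfl
      intro j _
      have a1 : (cnt (fun p => cd p + 1 ≤ mx p ∧ mx p - 2 = j) n : ℤ)
          = bc (j+1) (j+2) n - bc (j+1) (j+1) n := by
        apply cnt_sub
        · intro p hp
          have := mx_pos_of hn hp
          have := cd_pos_of hn hp
          omega
        · intro p hp
          have := mx_pos_of hn hp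
          have := cd_pos_of hn hp
          omega
      have a2 : (cnt (fun p => mx p + 1 ≤ cd p ∧ cd p - 2 = j) n : ℤ)
          = bc (j+2) (j+1) n - bc (j+1) (j+1) n := by
        apply cnt_sub
        · intro p hp
          have := mx_pos_of hn hp
          have := cd_pos_of hn hp
          omega
        · intro p hp
          have := mx_pos_of hn hp
          have := cd_pos_of hn hp
          omega
      rw [a1, a2, ← coeff_b, ← coeff_b (j+2), b_symm]
    · intro p hp _
      have := mx_pos_of hn hp
      have := cd_pos_of hn hp
      have := mx_le_tot p
      rw [mem_ov] at hp
      omega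
    · intro p hp _
      have := mx_pos_of hn hp
      have := cd_pos_of hn hp
      rw [mem_ov] at hp
      have := cd_le_tot p hp.1
      omega
  rw [h1]
  unfold G oc
  rw [cnt_split (fun _ => True) (fun p => cd p + 0 ≤ mx p)]
  congr 1
  · apply cnt_congr; intro p _; simp
  · apply cnt_congr; intro p _; simp

/-- no non-overlined parts `≤ J` -/
noncomputable def cJ (J n : ℕ) : ℕ := cnt (fun p => ∀ i ∈ p.2, J < i) n

lemma cJ_zero (n : ℕ) : cJ 0 n = oc n := by
  apply cnt_congr
  intro p hp
  rw [mem_ov] at hp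
  simpa using hp.1.2

lemma cJ_rec (J n : ℕ) : cJ J (n+(J+1)) = cJ (J+1) (n+(J+1)) + cJ J n := by
  unfold cJ
  rw [cnt_split _ (fun p => (J+1) ∈ p.2), add_comm]
  congr 1
  · apply cnt_congr
    intro p _
    constructor
    · rintro ⟨h1, h2⟩ i hi
      have := h1 i hi
      have : i ≠ J+1 := fun h => h2 (h ▸ hi)
      omega
    · intro h
      refine ⟨fun i hi => ?_, fun hm => ?_⟩
      · have := h i hi; omega
      · have := h _ hm; omega
  · symm
    rw [cnt_cons (fun p => ∀ i ∈ p.2, J < i) (fun p => ∀ i ∈ p.2, J < i) n (J+1) (by omega)]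
    · apply cnt_congr; intro p _; tauto
    · intro s t
      simp

lemma cJ_rec' (J n : ℕ) (h : n ≤ J) : cJ J n = cJ (J+1) n := by
  apply cnt_congr
  intro p hp
  rw [mem_ov] at hp
  constructor
  · intro h1 i hi
    have := h1 i hi
    have := (((mx_le _ _).1 (mx_le_tot p))).2 i hi
    omega
  · intro h1 i hi
    have := h1 i hi
    omega

end RankAux

open scoped BigOperators
open Filter MeasureTheory

namespace RankAux

lemma shift_sum_le (f : ℕ → ℝ) (hf : ∀ n, 0 ≤ f n) (x : ℝ) (hx : 0 ≤ x) (d M : ℕ) :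
    ∑ n ∈ Finset.range M, (if d ≤ n then f (n-d) * x^n else 0) ≤
      x^d * ∑ n ∈ Finset.range M, f n * x^n := by
  calc ∑ n ∈ Finset.range M, (if d ≤ n then f (n-d) * x^n else 0)
      ≤ ∑ n ∈ Finset.range (d + M), (if d ≤ n then f (n-d) * x^n else 0) := by
        apply Finset.sum_le_sum_of_subset_of_nonneg
        · intro n hn; simp at hn ⊢; omega
        · intro n _ _
          split_ifs
          · exact mul_nonneg (hf _) (pow_nonneg hx _)
          · exact le_refl _
    _ = x^d * ∑ n ∈ Finset.range M, f n * x^n := by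
        rw [Finset.sum_range_add, Finset.sum_eq_zero, zero_add, Finset.mul_sum]
        · apply Finset.sum_congr rfl
          intro n _
          rw [if_pos (by omega), Nat.add_sub_cancel_left, pow_add]; ring
        · intro n hn
          rw [if_neg]
          simp at hn; omega

lemma bc_bound (x : ℝ) (hx : 0 ≤ x) (hx1 : x < 1) (M L k : ℕ) :
    ∑ n ∈ Finset.range M, (bc k L n : ℝ) * x^n ≤
      ∏ j ∈ Finset.range L, ((1 + x^(j+1)) / (1 - x^(j+1))) := by
  have hpow : ∀ j : ℕ, 0 < 1 - x^(j+1) := fun j => by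
    have := pow_lt_one₀ hx hx1 (n := j+1) (by omega); linarith
  have hone : ∑ n ∈ Finset.range M, ((if n = 0 then 1 else 0 : ℕ) : ℝ) * x^n ≤ 1 := by
    calc _ ≤ ∑ n ∈ Finset.range (M+1), ((if n = 0 then 1 else 0 : ℕ) : ℝ) * x^n := by
          apply Finset.sum_le_sum_of_subset_of_nonneg
          · intro n hn; simp at hn ⊢; omega
          · intro n _ _; positivity
      _ = 1 := by
          rw [Finset.sum_range_succ']; simp
  induction L generalizing k with
  | zero => simp only [bc_zero_right]; simpa using hone
  | succ L ihL =>
    induction k with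
    | zero =>
      simp only [bc_zero_left]
      refine hone.trans ?_
      apply Finset.one_le_prod
      intro j _
      rw [one_le_div (hpow j)]
      have := pow_nonneg hx (j+1)
      linarith
    | succ k ihk =>
      have h1 : ∀ n, (bc (k+1) (L+1) n : ℝ) * x^n = (bc (k+1) L n : ℝ) * x^n +
          ((if L+1 ≤ n then (bc k (L+1) (n-(L+1)) : ℝ) * x^n else 0) +
          (if L+1 ≤ n then (bc k L (n-(L+1)) : ℝ) * x^n else 0)) := by
        intro n
        split_ifs with h
        · obtain ⟨m, rfl⟩ := Nat.exists_eq_add_of_le' h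
          rw [bc_rec, Nat.add_sub_cancel]; push_cast; ring
        · rw [bc_rec' _ _ _ (by omega)]; ring
      simp only [h1, Finset.sum_add_distrib]
      have h2 := shift_sum_le (fun n => (bc k (L+1) n : ℝ)) (fun n => by positivity) x hx (L+1) M
      have h3 := shift_sum_le (fun n => (bc k L n : ℝ)) (fun n => by positivity) x hx (L+1) M
      have h4 := ihL (k+1)
      have h5 := ihL k
      rw [Finset.prod_range_succ] at ihk ⊢
      set Q := ∏ j ∈ Finset.range L, ((1 + x^(j+1)) / (1 - x^(j+1))) with hQ
      set y := x^(L+1) with hy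
      have hy0 : 0 ≤ y := pow_nonneg hx _
      have hy1 : 0 < 1 - y := hpow L
      have e : Q * ((1+y)/(1-y)) = Q + y * (Q * ((1+y)/(1-y)) + Q) := by
        field_simp; ring
      rw [e]
      have h6 := mul_le_mul_of_nonneg_left ihk hy0
      have h7 := mul_le_mul_of_nonneg_left h5 hy0
      linarith

lemma bc_self (M n : ℕ) (h : n ≤ M) : bc M M n = oc n := by
  apply cnt_congr
  intro p hp
  have := mx_le_tot p
  rw [mem_ov] at hp
  have := cd_le_tot p hp.1
  constructor
  · intro _; trivial
  · intro _; constructor <;> omega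

lemma oc_summable (x : ℝ) (hx : 0 ≤ x) (hx1 : x < 1) : Summable (fun n => (oc n : ℝ) * x^n) := by
  apply summable_of_sum_range_le (c := Real.exp (2 * (1-x)⁻¹ * (1-x)⁻¹))
  · intro n; positivity
  · intro M
    have h1 : ∑ n ∈ Finset.range M, (oc n : ℝ) * x^n = ∑ n ∈ Finset.range M, (bc M M n : ℝ) * x^n := by
      apply Finset.sum_congr rfl
      intro n hn
      rw [bc_self M n (by simp at hn; omega)]
    rw [h1]
    refine (bc_bound x hx hx1 M M M).trans ?_
    have hx' : 0 < 1 - x := by linarith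
    calc _ ≤ ∏ j ∈ Finset.range M, Real.exp (2 * (1-x)⁻¹ * x^j) := by
          apply Finset.prod_le_prod
          · intro j _
            have := pow_lt_one₀ hx hx1 (n := j+1) (by omega)
            have := pow_nonneg hx (j+1)
            apply div_nonneg <;> linarith
          · intro j _
            have h2 := pow_lt_one₀ hx hx1 (n := j+1) (by omega)
            have h3 := pow_nonneg hx (j+1)
            have h3' := pow_nonneg hx j
            have h4 : x^(j+1) ≤ x := by
              have := pow_le_pow_of_le_one hx hx1.le (show 1 ≤ j+1 by omega); simpa using this
            have h5 : x^(j+1) ≤ x^j := pow_le_pow_of_le_one hx hx1.le (by omega)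
            have h6 : (1 + x^(j+1)) / (1 - x^(j+1)) = 2 * x^(j+1) / (1 - x^(j+1)) + 1 := by
              have : 1 - x^(j+1) ≠ 0 := by linarith
              field_simp; ring
            rw [h6]
            refine le_trans ?_ (Real.add_one_le_exp _)
            gcongr
            rw [show 2 * (1-x)⁻¹ * x^j = 2 * x^j / (1-x) by field_simp]
            gcongr
      _ = Real.exp (2 * (1-x)⁻¹ * ∑ j ∈ Finset.range M, x^j) := by
          rw [← Real.exp_sum, Finset.mul_sum]
      _ ≤ _ := by
          apply Real.exp_le_exp.2
          gcongr
          rw [← tsum_geometric_of_lt_one hx hx1]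
          exact (summable_geometric_of_lt_one hx hx1).sum_le_tsum _ (fun i _ => pow_nonneg hx i)

lemma cnt_eq_card (P : OP → Prop) (n : ℕ) : cnt P n = Nat.card {p : OP // p ∈ ov n ∧ P p} := by
  classical
  unfold cnt
  rw [← Fintype.card_coe, ← Nat.card_eq_fintype_card]
  apply Nat.card_congr
  exact Equiv.subtypeEquivRight (fun p => by rw [Finset.mem_filter])

lemma Nbar_eq (m n : ℕ) : Nbar ((m : ℤ) + 1) n = cnt (fun p => mx p = cd p + (m+1)) n := by
  unfold Nbar
  rw [cnt_eq_card]
  apply Nat.card_congr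
  refine
    { toFun := fun p => ⟨(p.1.overlined, p.1.nonoverlined), ?_⟩
      invFun := fun q => ⟨⟨q.1.1, q.1.2, ?_, ?_, ?_⟩, ?_⟩
      left_inv := ?_
      right_inv := ?_ }
  · rw [mem_ov]
    refine ⟨⟨⟨p.1.overlined_pos, p.1.nonoverlined_pos⟩, p.1.total⟩, ?_⟩
    have := p.2
    simp only [Overpartition.rank, Overpartition.parts, Multiset.card_add, Finset.card_val] at this
    simp only [mx, cd]
    omega
  · have := q.2; rw [mem_ov] at this; exact this.1.1.1
  · have := q.2; rw [mem_ov] at this; exact this.1.1.2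
  · have := q.2; rw [mem_ov] at this; exact this.1.2
  · have := q.2
    have := this.2
    simp only [Overpartition.rank, Overpartition.parts, Multiset.card_add, Finset.card_val]
    simp only [mx, cd] at this
    omega
  · intro p; rfl
  · intro q; rfl

lemma Nbar_eq' (m n : ℕ) : (Nbar ((m : ℤ) + 1) n : ℝ) = (G (m+1) n : ℝ) - G (m+2) n := by
  rw [Nbar_eq]
  have : (cnt (fun p => mx p = cd p + (m+1)) n : ℤ) = G (m+1) n - G (m+2) n := by
    apply cnt_sub
    · intro p hp; omega
    · intro p hp; omega
  exact_mod_cast this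

lemma Nplus_eq (r n : ℕ) (hr : 1 ≤ r) (hn : 0 < n) :
    Nplus r n = ∑ m ∈ Finset.range n, (((m : ℝ)+1)^r - (m:ℝ)^r) * G (m+1) n := by
  unfold Nplus
  rw [tsum_eq_sum (s := Finset.range n)]
  · have : ∀ M : ℕ, ∑ m ∈ Finset.range M, ((m : ℝ)+1)^r * (Nbar ((m : ℤ) + 1) n : ℝ) =
        ∑ m ∈ Finset.range M, (((m : ℝ)+1)^r - (m:ℝ)^r) * G (m+1) n - (M:ℝ)^r * G (M+1) n := by
      intro M
      induction M with
      | zero => simp; left; omega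
      | succ M ih =>
        rw [Finset.sum_range_succ, Finset.sum_range_succ, ih, Nbar_eq']
        push_cast
        ring
    rw [this n, G_zero_of_le (n+1) n hn (by omega)]
    simp
  · intro m hm
    rw [Nbar_eq', G_zero_of_le _ _ hn (by simp at hm; omega), G_zero_of_le _ _ hn (by simp at hm; omega)]
    simp

/-- real-valued counting sequence extended by zero to the negatives: `oz n j = oc (n - j)`. -/
noncomputable def oz (n j : ℕ) : ℝ := if j ≤ n then (oc (n-j) : ℝ) else 0

lemma oz_nonneg (n j : ℕ) : 0 ≤ oz n j := by
  unfold oz; split_ifs <;> positivity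

/-- Twice the averaged tail count. -/
noncomputable def H (m n : ℕ) : ℝ := (G m n : ℝ) + G (m+1) n

lemma H_nonneg (m n : ℕ) : 0 ≤ H m n := by unfold H; positivity

lemma G_zero_zero (m : ℕ) (h : 0 < m) : G m 0 = 0 := by
  apply cnt_zero_of
  intro p hp
  have := mx_le_tot p
  rw [mem_ov] at hp
  omega

lemma H_step (m n : ℕ) (h : 0 < n ∨ 0 < m) :
    H m n = 2 * oz n (m+1) - (if m+1 ≤ n then H (m+2) (n-(m+1)) else 0) := by
  unfold oz
  split_ifs with h1
  · obtain ⟨k, rfl⟩ := Nat.exists_eq_add_of_le' h1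
    rw [Nat.add_sub_cancel]
    have := dyson' m k
    unfold H
    have h2 : ((G m (k+(m+1)) : ℝ) + G (m+1) (k+(m+1)) + (G (m+2) k + G (m+3) k)) = 2 * oc k := by
      exact_mod_cast this
    have e : m + 2 + 1 = m + 3 := rfl
    rw [e]
    linarith
  · have h3 : G m n = 0 := by
      rcases Nat.eq_zero_or_pos n with rfl | hn
      · exact G_zero_zero _ (by omega)
      · exact G_zero_of_le _ _ hn (by omega)
    have h4 := G_anti m n
    have h5 : G (m+1) n = 0 := by omega
    simp [H, h3, h5]

lemma H_iter (m n : ℕ) (hn : 0 < n) (M : ℕ) :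
    H m n = 2 * ∑ k ∈ Finset.range M, (-1)^k * oz n ((k+1)*(k+1) + (k+1)*m)
      + (-1)^M * (if M*M+M*m ≤ n then H (m+2*M) (n-(M*M+M*m)) else 0) := by
  induction M with
  | zero => simp
  | succ M ih =>
    rw [ih, Finset.sum_range_succ]
    have e : (M+1)*(M+1)+(M+1)*m = (M*M+M*m) + (m+2*M+1) := by ring
    rw [e]
    set s := M*M+M*m with hs
    by_cases h1 : s ≤ n
    · rw [if_pos h1, H_step (m+2*M) (n-s)]
      · have e1 : oz (n-s) (m+2*M+1) = oz n (s+(m+2*M+1)) := by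
          unfold oz
          by_cases h2 : m+2*M+1 ≤ n - s
          · rw [if_pos h2, if_pos (by omega)]; congr 2; omega
          · rw [if_neg h2, if_neg (by omega)]
        rw [e1]
        have e2 : (if m+2*M+1 ≤ n-s then H (m+2*M+2) (n-s-(m+2*M+1)) else 0)
          = (if s+(m+2*M+1) ≤ n then H (m+2*(M+1)) (n-(s+(m+2*M+1))) else 0) := by
          by_cases h2 : m+2*M+1 ≤ n - s
          · rw [if_pos h2, if_pos (by omega)]; congr 1; omega
          · rw [if_neg h2, if_neg (by omega)]
        rw [e2, pow_succ]
        ring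
      · rcases Nat.eq_zero_or_pos M with h | h
        · subst h; left; simp at hs; omega
        · right; omega
    · rw [if_neg h1, if_neg (by omega)]
      have : oz n (s+(m+2*M+1)) = 0 := by unfold oz; rw [if_neg (by omega)]
      rw [this]; simp

lemma H_le (m n : ℕ) (hn : 0 < n) : H m n ≤ 2 * oz n (m+1) := by
  rw [H_step m n (Or.inl hn)]
  split_ifs
  · have := H_nonneg (m+2) (n-(m+1)); linarith
  · simp

lemma H_hasSum (m n : ℕ) (hn : 0 < n) :
    HasSum (fun k : ℕ => (-1)^k * oz n ((k+1)*(k+1) + (k+1)*m)) (H m n / 2) := by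
  have h := H_iter m n hn (n+1)
  rw [if_neg (by nlinarith)] at h
  have e : H m n / 2 = ∑ k ∈ Finset.range (n+1), (-1)^k * oz n ((k+1)*(k+1) + (k+1)*m) := by
    rw [h]; ring
  rw [e]
  apply hasSum_sum_of_ne_finset_zero
  intro k hk
  simp at hk
  unfold oz
  rw [if_neg (by nlinarith)]; simp

lemma oc_hasSum (n : ℕ) (hn : 0 < n) :
    HasSum (fun k : ℕ => (-1)^k * oz n ((k+1)*(k+1))) ((oc n : ℝ) / 2) := by
  have h := H_hasSum 0 n hn
  have e : H 0 n = oc n := by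
    unfold H; exact_mod_cast G_sym n hn
  rw [e] at h
  simpa using h

end RankAux

open scoped BigOperators
open Filter MeasureTheory

namespace RankAux

lemma hasSum_congr' {ι : Type*} {f g : ι → ℂ} {a : ℂ} (h : ∀ b, f b = g b) :
    HasSum f a ↔ HasSum g a := by
  rw [funext h]

/-- The generating function of overpartitions. -/
noncomputable def FF (q : ℂ) : ℂ := ∑' n : ℕ, (oc n : ℂ) * q ^ n

/-- The real generating function of overpartitions. -/
noncomputable def FR (x : ℝ) : ℝ := ∑' n : ℕ, (oc n : ℝ) * x ^ n

lemma FF_norm_summable (q : ℂ) (hq : ‖q‖ < 1) : Summable (fun n : ℕ => ‖(oc n : ℂ) * q ^ n‖) := by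
  have := oc_summable ‖q‖ (norm_nonneg _) hq
  simpa using this

lemma FF_summable (q : ℂ) (hq : ‖q‖ < 1) : Summable (fun n : ℕ => (oc n : ℂ) * q ^ n) :=
  (FF_norm_summable q hq).of_norm

lemma hasSum_shift {f : ℕ → ℂ} {s : ℂ} (h : HasSum f s) (d : ℕ) :
    HasSum (fun n => if d ≤ n then f (n - d) else 0) s := by
  have := (Function.Injective.hasSum_iff (f := fun n => if d ≤ n then f (n - d) else 0) (a := s)
    (add_left_injective d) ?_).1 ?_
  · exact this
  · intro n hn
    by_cases hd : d ≤ n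
    · exfalso; apply hn; exact ⟨n - d, by simp; omega⟩
    · simp [hd]
  · have e : (fun n => if d ≤ n then f (n - d) else 0) ∘ (fun n => n + d) = f := by
      funext n; simp
    rw [e]; exact h

lemma oz_hasSum (q : ℂ) (hq : ‖q‖ < 1) (d : ℕ) :
    HasSum (fun N : ℕ => (oz N d : ℂ) * q ^ N) (q ^ d * FF q) := by
  have h := hasSum_shift ((FF_summable q hq).hasSum.mul_left (q^d)) d
  convert h using 2
  rename_i N
  unfold oz
  split_ifs with hd
  · have : q ^ N = q ^ d * q ^ (N - d) := by rw [← pow_add]; congr 1; omega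
    rw [this]; push_cast; ring
  · simp
  · rfl

lemma FR_eq (x : ℝ) : (FR x : ℂ) = FF x := by
  unfold FR FF; push_cast; rfl

lemma oz_hasSum_real (x : ℝ) (h0 : 0 ≤ x) (hx : x < 1) (d : ℕ) :
    HasSum (fun N : ℕ => (oz N d : ℝ) * x ^ N) (x ^ d * FR x) := by
  have := oz_hasSum (x : ℂ) (by simpa [abs_of_nonneg h0] using hx) d
  rw [← FR_eq] at this
  exact_mod_cast this

lemma sq_summable (x : ℝ) (h0 : 0 ≤ x) (hx : x < 1) :
    Summable (fun k : ℕ => x ^ ((k+1)*(k+1))) := by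
  refine Summable.of_nonneg_of_le (fun k => pow_nonneg h0 _) (fun k => ?_)
    (summable_geometric_of_lt_one h0 hx)
  exact pow_le_pow_of_le_one h0 hx.le (by nlinarith)

lemma FF_theta_aux (q : ℂ) (hq : ‖q‖ < 1) :
    HasSum (fun k : ℕ => (-1 : ℂ)^k * (q ^ ((k+1)*(k+1)) * FF q)) ((FF q - 1)/2) := by
  set f : ℕ × ℕ → ℂ := fun p => (-1 : ℂ)^p.1 * ((oz p.2 ((p.1+1)*(p.1+1)) : ℂ) * q ^ p.2) with hf
  have hnorm : ∀ k N, ‖f (k, N)‖ = oz N ((k+1)*(k+1)) * ‖q‖^N := by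
    intro k N
    simp [hf, abs_of_nonneg (oz_nonneg _ _)]
  have hs : Summable f := by
    apply Summable.of_norm
    rw [summable_prod_of_nonneg (fun _ => norm_nonneg _)]
    have h1 : ∀ k : ℕ, HasSum (fun N => ‖f (k, N)‖) (‖q‖ ^ ((k+1)*(k+1)) * FR ‖q‖) := by
      intro k
      simp only [hnorm]
      exact oz_hasSum_real _ (norm_nonneg _) hq _
    refine ⟨fun k => (h1 k).summable, ?_⟩
    simp only [fun k => (h1 k).tsum_eq]
    exact (sq_summable _ (norm_nonneg _) hq).mul_right _
  have hA : HasSum (fun k : ℕ => (-1 : ℂ)^k * (q ^ ((k+1)*(k+1)) * FF q)) (∑' p, f p) := by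
    refine HasSum.prod_fiberwise hs.hasSum (fun k => ?_)
    have h := (oz_hasSum q hq ((k+1)*(k+1))).mul_left ((-1:ℂ)^k)
    simpa only [hf] using h
  have hB : HasSum (fun N : ℕ => if N = 0 then (0:ℂ) else (oc N : ℂ)/2 * q^N) (∑' p, f p) := by
    have h2 : HasSum (f ∘ Prod.swap) (∑' p, f p) :=
      ((Equiv.prodComm ℕ ℕ).hasSum_iff (f := f)).2 hs.hasSum
    apply h2.prod_fiberwise
    intro N
    simp only [Function.comp, Prod.swap, hf]
    split_ifs with h0
    · subst h0
      have : ∀ k, oz 0 ((k+1)*(k+1)) = 0 := by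
        intro k; unfold oz; rw [if_neg]; nlinarith
      simp only [this]
      simpa using (hasSum_zero : HasSum (fun _ : ℕ => (0:ℂ)) 0)
    · have h := (Complex.hasSum_ofReal.2 (oc_hasSum N (by omega))).mul_right (q^N)
      push_cast at h
      simpa only [mul_assoc] using h
  have hC : HasSum (fun N : ℕ => if N = 0 then (0:ℂ) else (oc N : ℂ)/2 * q^N) ((FF q - 1)/2) := by
    have h := ((FF_summable q hq).hasSum.sub (hasSum_ite_eq 0 (1:ℂ))).div_const 2
    refine (hasSum_congr' (fun N => ?_)).mpr h
    split_ifs with h0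
    · subst h0; simp [oc_zero]
    · ring
  rw [hC.unique hB]
  exact hA

lemma FF_theta (z : ℂ) (hz : 0 < z.re) :
    FF (Complex.exp (-z)) * jacobiTheta₂ (1/2) (Complex.I * z / Real.pi) = 1 := by
  set q := Complex.exp (-z) with hqdef
  have hq : ‖q‖ < 1 := by
    rw [hqdef, Complex.norm_exp]; simpa using hz
  have hT := FF_theta_aux q hq
  have hsum : Summable (fun k : ℕ => (-1 : ℂ)^k * q ^ ((k+1)*(k+1))) := by
    apply Summable.of_norm
    simpa using sq_summable ‖q‖ (norm_nonneg _) hq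
  have hT2 := hsum.hasSum.mul_right (FF q)
  simp only [mul_assoc] at hT2
  have e1 := hT2.unique hT
  set T := ∑' k : ℕ, (-1 : ℂ)^k * q ^ ((k+1)*(k+1))
  have him : 0 < (Complex.I * z / Real.pi).im := by
    rw [Complex.div_ofReal_im]
    simp only [Complex.mul_im, Complex.I_re, Complex.I_im, zero_mul, one_mul, zero_add]
    exact div_pos hz Real.pi_pos
  have hth := hasSum_jacobiTheta₂_term (1/2) him
  have hterm : ∀ n : ℤ, jacobiTheta₂_term n (1/2) (Complex.I * z / Real.pi) =
      Complex.exp (Real.pi * Complex.I)^n * Complex.exp (-z * n^2) := by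
    intro n
    unfold jacobiTheta₂_term
    rw [← Complex.exp_int_mul, ← Complex.exp_add]
    congr 1
    have : (Real.pi : ℂ) ≠ 0 := by exact_mod_cast Real.pi_ne_zero
    field_simp
    linear_combination (- (n:ℂ)^2 * z) * (-1) + (z * n^2) * Complex.I_sq
  have hq2 : ∀ k : ℕ, Complex.exp (-z * ((k:ℂ)+1)^2) = q ^ ((k+1)*(k+1)) := by
    intro k
    rw [hqdef, ← Complex.exp_nat_mul]
    congr 1; push_cast; ring
  have h2 : HasSum (fun n : ℤ => jacobiTheta₂_term n (1/2) (Complex.I * z / Real.pi)) (-T + 1 + -T) := by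
    have h0 : jacobiTheta₂_term 0 (1/2) (Complex.I * z / Real.pi) = 1 := by
      rw [hterm]; simp
    have key := HasSum.of_add_one_of_neg_add_one (f := fun n : ℤ => jacobiTheta₂_term n (1/2) (Complex.I * z / Real.pi))
      (m := -T) (m' := -T) ?_ ?_
    · simpa only [h0] using key
    · refine (hasSum_congr' (fun k => ?_)).mpr hsum.hasSum.neg
      rw [hterm]
      push_cast
      rw [hq2, Complex.exp_pi_mul_I]
      norm_cast
      rw [pow_succ]; push_cast; ring
    · refine (hasSum_congr' (fun k => ?_)).mpr hsum.hasSum.neg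
      rw [hterm]
      push_cast
      rw [neg_sq, hq2, Complex.exp_pi_mul_I, zpow_neg, ← inv_zpow]
      norm_num
      norm_cast
      rw [pow_succ]; push_cast; ring
  rw [hth.unique h2]
  linear_combination 2 * (-1) * e1
end RankAux

open scoped BigOperators
open Filter MeasureTheory

namespace RankAux

/-- The transformed theta function. -/
noncomputable def EE (w : ℂ) : ℂ :=
  jacobiTheta₂ (-Complex.I * w / (2 * Real.pi)) (Complex.I * w / Real.pi)

lemma FF_EE (z : ℂ) (hz : 0 < z.re) :
    FF (Complex.exp (-z)) * EE (Real.pi^2 / z) =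
      (z / Real.pi) ^ (1/2 : ℂ) * Complex.exp (Real.pi^2 / (4 * z)) := by
  have h := FF_theta z hz
  have hz0 : z ≠ 0 := by rintro rfl; simp at hz
  have hpi : (Real.pi : ℂ) ≠ 0 := by exact_mod_cast Real.pi_ne_zero
  have hI := Complex.I_sq
  rw [jacobiTheta₂_functional_equation] at h
  have e1 : -Complex.I * (Complex.I * z / Real.pi) = z / Real.pi := by
    field_simp; linear_combination -hI
  have e2 : -Real.pi * Complex.I * (1/2)^2 / (Complex.I * z / Real.pi) = -(Real.pi^2 / (4*z)) := by
    field_simp; norm_num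
  have e3 : (1/2 : ℂ) / (Complex.I * z / Real.pi) = -Complex.I * (Real.pi^2 / z) / (2 * Real.pi) := by
    field_simp; linear_combination hI
  have e4 : -1 / (Complex.I * z / Real.pi) = Complex.I * (Real.pi^2 / z) / Real.pi := by
    field_simp; linear_combination -hI
  rw [e1, e2, e3, e4, Complex.exp_neg (Real.pi^2 / (4*z))] at h
  change _ * (_ * EE _) = _ at h
  have hne : (z / Real.pi) ^ (1/2 : ℂ) ≠ 0 := by
    rw [Complex.cpow_ne_zero_iff]; left; exact div_ne_zero hz0 hpi
  have hexp := Complex.exp_ne_zero (Real.pi^2 / (4*z))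
  generalize Complex.exp (Real.pi^2 / (4*z)) = A at *
  generalize (z / Real.pi) ^ (1/2 : ℂ) = B at *
  generalize FF (Complex.exp (-z)) = C at *
  generalize EE (Real.pi^2 / z) = D at *
  field_simp at h
  linear_combination h

lemma EE_bound (w : ℂ) (hw : 1 ≤ w.re) : ‖EE w - 2‖ ≤ 4 * Real.exp (-2 * w.re) := by
  have hpi : (Real.pi : ℂ) ≠ 0 := by exact_mod_cast Real.pi_ne_zero
  have him : 0 < (Complex.I * w / Real.pi).im := by
    rw [Complex.div_ofReal_im]
    simp only [Complex.mul_im, Complex.I_re, Complex.I_im, zero_mul, one_mul, zero_add]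
    exact div_pos (by linarith) Real.pi_pos
  have hth := hasSum_jacobiTheta₂_term (-Complex.I * w / (2 * Real.pi)) him
  have hterm : ∀ n : ℤ, jacobiTheta₂_term n (-Complex.I * w / (2 * Real.pi)) (Complex.I * w / Real.pi) =
      Complex.exp (-w * (n * (n-1))) := by
    intro n
    unfold jacobiTheta₂_term
    congr 1
    field_simp
    linear_combination (-w * n + w * n^2) * Complex.I_sq
  simp only [hterm] at hth
  set x := Real.exp (-2 * w.re) with hx
  have hx0 : 0 < x := Real.exp_pos _
  have hx1 : x ≤ 1/4 := by
    have h2 : Real.exp (-2 * w.re) ≤ Real.exp (-2) := Real.exp_le_exp.2 (by linarith)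
    have h3 : Real.exp (-2) = (Real.exp 1)⁻¹^2 := by rw [← Real.exp_neg, ← Real.exp_nat_mul]; norm_num
    have h4 := Real.exp_one_gt_d9
    have h5 : (Real.exp 1)⁻¹ ≤ 1/2 := by
      rw [inv_le_comm₀ (Real.exp_pos _) (by norm_num)]; linarith
    have h6 : 0 < (Real.exp 1)⁻¹ := by positivity
    rw [h3] at h2
    nlinarith
  have hgeo := (hasSum_geometric_of_lt_one hx0.le (by linarith : x < 1)).mul_left x
  have hb : ∀ k : ℕ, ‖Complex.exp (-w * ((k+1)*(k+2)))‖ ≤ x * x^k := by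
    intro k
    rw [Complex.norm_exp, ← pow_succ', hx, ← Real.exp_nat_mul]
    apply Real.exp_le_exp.2
    have : (-w * (((k:ℂ)+1)*(k+2))).re = -(w.re * ((k+1)*(k+2))) := by
      have : (-w * (((k:ℂ)+1)*(k+2))) = -(((((k:ℝ)+1)*(k+2) : ℝ) : ℂ) * w) := by push_cast; ring
      rw [this, Complex.neg_re, Complex.re_ofReal_mul]; ring
    rw [this]
    push_cast
    have hk : (0:ℝ) ≤ k := Nat.cast_nonneg k
    nlinarith [mul_nonneg (mul_nonneg (by linarith : (0:ℝ) ≤ w.re) hk) (by linarith : (0:ℝ) ≤ k+1)]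
  have hS : Summable (fun k : ℕ => Complex.exp (-w * ((k+1)*(k+2)))) :=
    Summable.of_norm_bounded hgeo.summable hb
  set S := ∑' k : ℕ, Complex.exp (-w * ((k+1)*(k+2))) with hSdef
  have hSn : ‖S‖ ≤ 2 * x := by
    have h1 := tsum_of_norm_bounded hgeo hb
    refine h1.trans ?_
    rw [mul_comm 2 x]
    apply mul_le_mul_of_nonneg_left _ hx0.le
    rw [inv_le_comm₀ (by linarith) (by norm_num)]; linarith
  have key := HasSum.of_add_one_of_neg_add_one (f := fun n : ℤ => Complex.exp (-w * (n * (n-1))))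
      (m := 1 + S) (m' := S) ?_ ?_
  · have h2 : EE w = 1 + S + 1 + S := by
      have := hth.unique key
      unfold EE
      rw [this]; simp
    rw [h2, show 1 + S + 1 + S - 2 = 2 * S by ring, norm_mul]
    simp; linarith
  · have h := (hasSum_nat_add_iff' (f := fun n : ℕ => Complex.exp (-w * ((((n:ℤ)+1 : ℤ):ℂ) * (((((n:ℤ)+1 : ℤ):ℂ))-1))))
      (g := 1 + S) 1).1
    apply h
    simp only [Finset.sum_range_one]
    have e : 1 + S - Complex.exp (-w * (((((0:ℕ):ℤ)+1 : ℤ):ℂ) * ((((((0:ℕ):ℤ)+1 : ℤ):ℂ))-1))) = S := by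
      simp
    rw [e]
    refine (hasSum_congr' (fun k => ?_)).mpr hS.hasSum
    congr 1; push_cast; ring
  · refine (hasSum_congr' (fun k => ?_)).mpr hS.hasSum
    congr 1; push_cast; ring

lemma EE_norm_ge (w : ℂ) (hw : 1 ≤ w.re) : 1 ≤ ‖EE w‖ := by
  have h := EE_bound w hw
  have hx1 : 4 * Real.exp (-2 * w.re) ≤ 1 := by
    have h2 : Real.exp (-2 * w.re) ≤ Real.exp (-2) := Real.exp_le_exp.2 (by linarith)
    have h3 : Real.exp (-2) = (Real.exp 1)⁻¹^2 := by rw [← Real.exp_neg, ← Real.exp_nat_mul]; norm_num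
    have h4 := Real.exp_one_gt_d9
    have h5 : (Real.exp 1)⁻¹ ≤ 1/2 := by
      rw [inv_le_comm₀ (Real.exp_pos _) (by norm_num)]; linarith
    have h6 : 0 < (Real.exp 1)⁻¹ := by positivity
    rw [h3] at h2
    nlinarith
  have h3 : ‖(2:ℂ)‖ - ‖EE w‖ ≤ ‖2 - EE w‖ := norm_sub_norm_le _ _
  rw [norm_sub_rev] at h3
  simp at h3
  linarith
end RankAux

open scoped BigOperators
open Filter MeasureTheory

namespace RankAux

lemma le_of_sq_le_sq' {a b : ℝ} (h : a^2 ≤ b^2) (hb : 0 ≤ b) : a ≤ b :=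
  (le_abs_self a).trans (abs_le_of_sq_le_sq h hb)

lemma cJ_le (J n : ℕ) : cJ J n ≤ oc n := cnt_mono (fun _ _ _ => trivial)

lemma cJ_summable (J : ℕ) (q : ℂ) (hq : ‖q‖ < 1) : Summable (fun n : ℕ => (cJ J n : ℂ) * q ^ n) := by
  apply Summable.of_norm_bounded (FF_norm_summable q hq)
  intro n
  simp only [norm_mul]
  apply mul_le_mul_of_nonneg_right _ (norm_nonneg _)
  simp only [Complex.norm_natCast]
  exact_mod_cast cJ_le J n

noncomputable def FJ (J : ℕ) (q : ℂ) : ℂ := ∑' n : ℕ, (cJ J n : ℂ) * q ^ n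

lemma FJ_zero (q : ℂ) : FJ 0 q = FF q := by
  unfold FJ FF; simp only [cJ_zero]

lemma FJ_succ (J : ℕ) (q : ℂ) (hq : ‖q‖ < 1) : FJ J q * (1 - q^(J+1)) = FJ (J+1) q := by
  have h1 := (cJ_summable J q hq).hasSum
  have h2 := hasSum_shift (h1.mul_left (q^(J+1))) (J+1)
  have h3 := h1.sub h2
  have h4 := (cJ_summable (J+1) q hq).hasSum
  have h5 : HasSum (fun n : ℕ => (cJ (J+1) n : ℂ) * q ^ n) (FJ J q - q^(J+1) * FJ J q) := by
    refine (hasSum_congr' (fun n => ?_)).mpr h3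
    split_ifs with hn
    · obtain ⟨m, rfl⟩ := Nat.exists_eq_add_of_le' hn
      rw [cJ_rec, Nat.add_sub_cancel]
      push_cast; ring
    · rw [cJ_rec' J n (by omega)]; simp
  have := h5.unique h4
  change _ = FJ (J+1) q at this
  rw [← this]; ring

lemma FJ_norm_le (J : ℕ) (q : ℂ) (hq : ‖q‖ < 1) : ‖FJ J q‖ ≤ ‖FJ J (‖q‖ : ℂ)‖ := by
  have h1 := (cJ_summable J (‖q‖ : ℂ) (by simpa using hq))
  have h2 : Summable (fun n : ℕ => (cJ J n : ℝ) * ‖q‖ ^ n) := by exact_mod_cast h1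
  have e : FJ J (‖q‖ : ℂ) = ((∑' n : ℕ, (cJ J n : ℝ) * ‖q‖ ^ n : ℝ) : ℂ) := by
    unfold FJ; push_cast; rfl
  rw [e, Complex.norm_real, Real.norm_eq_abs]
  refine le_trans ?_ (le_abs_self _)
  apply tsum_of_norm_bounded h2.hasSum
  intro n; simp

lemma FF_norm_le (q : ℂ) (hq : ‖q‖ < 1) : ‖FF q‖ ≤ ‖FF (‖q‖ : ℂ)‖ := by
  have := FJ_norm_le 0 q hq
  simpa only [FJ_zero] using this

lemma FF_prod (q : ℂ) (hq : ‖q‖ < 1) :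
    FF q * (1-q) * (1-q^2) * (1-q^3) * (1-q^4) = FJ 4 q := by
  rw [← FJ_succ 3 q hq, ← FJ_succ 2 q hq, ← FJ_succ 1 q hq, ← FJ_succ 0 q hq, FJ_zero]
  norm_num

lemma one_sub_norm (q : ℂ) (t θ : ℝ) (hq : q = Complex.exp (-(t + θ * Complex.I))) (j : ℕ) :
    ‖1 - q^j‖^2 = (1 - Real.exp (-(j*t)))^2 + 4 * Real.exp (-(j*t)) * Real.sin (j*θ/2)^2 := by
  have e : q^j = Complex.exp ((-(j*t) : ℝ)) * Complex.exp (((-(j*θ) : ℝ) : ℂ) * Complex.I) := by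
    rw [hq, ← Complex.exp_nat_mul, ← Complex.exp_add]; congr 1; push_cast; ring
  rw [e, Complex.exp_mul_I, ← Complex.ofReal_exp, ← Complex.ofReal_cos, ← Complex.ofReal_sin,
    Real.cos_neg, Real.sin_neg]
  have e2 : (1 : ℂ) - (Real.exp (-(j*t)) : ℂ) * ((Real.cos (j*θ) : ℂ) + ((-Real.sin (j*θ) : ℝ) : ℂ) * Complex.I)
     = ((1 - Real.exp (-(j*t)) * Real.cos (j*θ) : ℝ) : ℂ) +
       ((Real.exp (-(j*t)) * Real.sin (j*θ) : ℝ) : ℂ) * Complex.I := by push_cast; ring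
  rw [e2, Complex.sq_norm, Complex.normSq_add_mul_I]
  have h1 : Real.cos (j*θ) = 1 - 2 * Real.sin (j*θ/2)^2 := by
    have := Real.cos_two_mul (j*θ/2)
    rw [show 2 * (j*θ/2) = j*θ by ring] at this
    have h2 := Real.sin_sq_add_cos_sq (j*θ/2)
    linarith
  have h2 := Real.sin_sq_add_cos_sq (j*θ)
  have h3 : Real.sin (j*θ)^2 = 1 - Real.cos (j*θ)^2 := by linarith
  rw [mul_pow _ (Real.sin (j*θ)), h3, h1]; ring

set_option maxHeartbeats 1000000 in
lemma minor_aux (t θ : ℝ) (ht : 0 < t) (ht' : t ≤ 1/4) (hθ : |θ| ≤ Real.pi) (hθt : t ≤ θ^2) :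
    ‖FF (Complex.exp (-(t + θ * Complex.I)))‖ ≤ 256 * t^2 * ‖FF (Complex.exp (-(t:ℂ)))‖ := by
  set q := Complex.exp (-(t + θ * Complex.I)) with hq
  have hnq : ‖q‖ = Real.exp (-t) := by rw [hq, Complex.norm_exp]; simp
  have hx1 : Real.exp (-t) < 1 := by simpa using ht
  have hq1 : ‖q‖ < 1 := by rw [hnq]; exact hx1
  set D : ℕ → ℝ := fun j => ‖1 - q^j‖ with hD
  set d : ℕ → ℝ := fun j => 1 - Real.exp (-(j*t)) with hd
  have hsq := one_sub_norm q t θ hq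
  have hd0 : ∀ j : ℕ, 1 ≤ j → 0 < d j := by
    intro j hj
    have : (1:ℝ) ≤ j := by exact_mod_cast hj
    have : Real.exp (-(j*t)) < 1 := by rw [Real.exp_lt_one_iff]; nlinarith
    simp only [hd]; linarith
  have hdt : ∀ j : ℕ, d j ≤ j * t := by
    intro j
    have := Real.add_one_le_exp (-(j*t))
    simp only [hd]; linarith
  have hdD : ∀ j : ℕ, 1 ≤ j → d j ≤ D j := by
    intro j hj
    apply le_of_sq_le_sq' _ (norm_nonneg _)
    rw [hsq]
    simp only [hd]
    have := Real.exp_pos (-(j*t))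
    nlinarith [sq_nonneg (Real.sin (j*θ/2))]
  have hsD : ∀ j : ℕ, j ≤ 4 → |Real.sin (j*θ/2)| ≤ D j := by
    intro j hj
    apply le_of_sq_le_sq' _ (norm_nonneg _)
    rw [hsq, sq_abs]
    have hj4 : (j:ℝ) ≤ 4 := by exact_mod_cast hj
    have h1 : 1/4 ≤ Real.exp (-(j*t)) := by
      have h4 := Real.exp_one_lt_d9
      have : Real.exp (-1) ≤ Real.exp (-(j*t)) := Real.exp_le_exp.2 (by nlinarith)
      rw [Real.exp_neg] at this
      refine le_trans ?_ this
      rw [one_div, inv_le_inv₀ (by norm_num) (Real.exp_pos _)]; linarith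
    nlinarith [sq_nonneg (Real.sin (j*θ/2)), sq_nonneg (1 - Real.exp (-(j*t)))]
  have hD0 : ∀ j : ℕ, 1 ≤ j → 0 < D j := fun j hj => (hd0 j hj).trans_le (hdD j hj)
  have main : d 1 * d 2 * d 3 * d 4 ≤ 256 * t^2 * (D 1 * D 2 * D 3 * D 4) := by
    have p1 := hd0 1 (by norm_num)
    have p2 := hd0 2 (by norm_num)
    have p3 := hd0 3 (by norm_num)
    have p4 := hd0 4 (by norm_num)
    have P1 := hD0 1 (by norm_num)
    have P2 := hD0 2 (by norm_num)
    have P3 := hD0 3 (by norm_num)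
    have P4 := hD0 4 (by norm_num)
    by_cases hc : |θ| ≤ Real.pi/4
    · set s := Real.sqrt t with hs
      have hs0 : 0 < s := Real.sqrt_pos.2 ht
      have hss : s * s = t := Real.mul_self_sqrt ht.le
      have hsθ : s ≤ |θ| := by
        rw [hs, ← Real.sqrt_sq_eq_abs]; exact Real.sqrt_le_sqrt hθt
      have hr : ∀ j : ℕ, 1 ≤ j → j ≤ 4 → d j ≤ 4 * s * D j := by
        intro j hj hj4
        have hj4' : (j:ℝ) ≤ 4 := by exact_mod_cast hj4
        have hj0 : (0:ℝ) ≤ j := Nat.cast_nonneg j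
        have h1 : j * |θ| / Real.pi ≤ D j := by
          refine le_trans ?_ (hsD j hj4)
          have h2 := Real.mul_abs_le_abs_sin (x := j*θ/2) (by
            rw [abs_div, abs_mul, abs_of_nonneg hj0, abs_two]
            nlinarith [abs_nonneg θ, Real.pi_pos])
          rw [abs_div, abs_mul, abs_of_nonneg hj0, abs_two] at h2
          calc j * |θ| / Real.pi = 2 / Real.pi * (j * |θ| / 2) := by field_simp
            _ ≤ _ := h2
        calc d j ≤ j * t := hdt j
          _ = j * s * s := by rw [← hss]; ring
          _ ≤ j * |θ| * s := by gcongr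
          _ = Real.pi * s * (j * |θ| / Real.pi) := by field_simp
          _ ≤ 4 * s * D j := by
            have := Real.pi_le_four
            gcongr
      calc d 1 * d 2 * d 3 * d 4 ≤ (4 * s * D 1) * (4 * s * D 2) * (4 * s * D 3) * (4 * s * D 4) := by
            have := hr 1 (by norm_num) (by norm_num)
            have := hr 2 (by norm_num) (by norm_num)
            have := hr 3 (by norm_num) (by norm_num)
            have := hr 4 (by norm_num) (by norm_num)
            gcongr
        _ = 256 * t^2 * (D 1 * D 2 * D 3 * D 4) := by rw [← hss]; ring
    · push Not at hc
      set S := Real.sin (θ/2) with hS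
      have hS1 : 1/4 ≤ |S| := by
        have h2 := Real.mul_abs_le_abs_sin (x := θ/2) (by rw [abs_div, abs_two]; linarith)
        rw [abs_div, abs_two] at h2
        refine le_trans ?_ h2
        rw [show 2 / Real.pi * (|θ|/2) = |θ| / Real.pi by field_simp, le_div_iff₀ Real.pi_pos]; linarith
      have hd1 : d 1 ≤ 4 * t * D 1 := by
        have h1 := hdt 1
        have h2 := hsD 1 (by norm_num)
        simp only [Nat.cast_one, one_mul] at h1 h2
        rw [← hS] at h2
        nlinarith
      have hSsq : 1/16 ≤ S^2 := by rw [← sq_abs]; nlinarith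
      have hcs := Real.sin_sq_add_cos_sq (θ/2)
      rw [← hS] at hcs
      have h23 : d 2 * d 3 ≤ 24 * t * (D 2 * D 3) := by
        by_cases h78 : 7/8 ≤ S^2
        · have h3 : 1/8 ≤ D 3 := by
            have h4 := hsD 3 (by norm_num)
            refine le_trans ?_ h4
            have e : Real.sin ((3:ℕ)*θ/2) = S * (3 - 4 * S^2) := by
              rw [show ((3:ℕ):ℝ)*θ/2 = 3 * (θ/2) by push_cast; ring, Real.sin_three_mul]; rw [← hS]; ring
            rw [e, abs_mul, abs_of_nonpos (by linarith : 3 - 4 * S^2 ≤ 0)]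
            nlinarith
          have h5 := hdt 3
          have h6 := hdD 2 (by norm_num)
          push_cast at h5
          have h7 : d 3 ≤ 24 * t * D 3 := by nlinarith
          nlinarith
        · push Not at h78
          have h3 : 1/8 ≤ D 2 := by
            have h4 := hsD 2 (by norm_num)
            refine le_trans ?_ h4
            have e : Real.sin ((2:ℕ)*θ/2) = 2 * S * Real.cos (θ/2) := by
              rw [show ((2:ℕ):ℝ)*θ/2 = 2 * (θ/2) by push_cast; ring, Real.sin_two_mul]
            rw [e]
            apply le_of_sq_le_sq' _ (abs_nonneg _)
            rw [sq_abs]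
            have : Real.cos (θ/2)^2 = 1 - S^2 := by linarith
            rw [mul_pow, mul_pow, this]
            nlinarith
          have h5 := hdt 2
          have h6 := hdD 3 (by norm_num)
          push_cast at h5
          have h7 : d 2 ≤ 24 * t * D 2 := by nlinarith
          nlinarith
      have h4 := hdD 4 (by norm_num)
      calc d 1 * d 2 * d 3 * d 4 = d 1 * (d 2 * d 3) * d 4 := by ring
        _ ≤ (4 * t * D 1) * (24 * t * (D 2 * D 3)) * D 4 := by gcongr
        _ = 96 * t^2 * (D 1 * D 2 * D 3 * D 4) := by ring
        _ ≤ 256 * t^2 * (D 1 * D 2 * D 3 * D 4) := by gcongr; norm_num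
  have hx : ((‖q‖ : ℝ) : ℂ) = Complex.exp (-(t:ℂ)) := by rw [hnq]; push_cast; rfl
  have hA := FJ_norm_le 4 q hq1
  rw [← FF_prod q hq1, ← FF_prod (‖q‖ : ℂ) (by simpa using hq1)] at hA
  simp only [norm_mul] at hA
  have hdn : ∀ j : ℕ, 1 ≤ j → ‖1 - ((‖q‖ : ℝ) : ℂ)^j‖ = d j := by
    intro j hj
    have : (1 - ((‖q‖ : ℝ) : ℂ)^j) = ((d j : ℝ) : ℂ) := by
      simp only [hd, hnq]; push_cast
      rw [← Complex.exp_nat_mul]; congr 2; ring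
    rw [this, Complex.norm_real, Real.norm_eq_abs, abs_of_pos (hd0 j hj)]
  have hdn1 := hdn 1 (by norm_num)
  rw [pow_one] at hdn1
  have hD1 : ‖1 - q‖ = D 1 := by simp [hD]
  rw [hdn1, hdn 2 (by norm_num), hdn 3 (by norm_num), hdn 4 (by norm_num), hD1] at hA
  rw [← hx]
  have hpos : 0 < D 1 * D 2 * D 3 * D 4 := by
    have P1 := hD0 1 (by norm_num)
    have P2 := hD0 2 (by norm_num)
    have P3 := hD0 3 (by norm_num)
    have P4 := hD0 4 (by norm_num)
    positivity
  refine le_of_mul_le_mul_right ?_ hpos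
  calc ‖FF q‖ * (D 1 * D 2 * D 3 * D 4) = ‖FF q‖ * D 1 * D 2 * D 3 * D 4 := by ring
    _ ≤ _ := hA
    _ = ‖FF ((‖q‖ : ℝ) : ℂ)‖ * (d 1 * d 2 * d 3 * d 4) := by ring
    _ ≤ ‖FF ((‖q‖ : ℝ) : ℂ)‖ * (256 * t^2 * (D 1 * D 2 * D 3 * D 4)) := by gcongr
    _ = _ := by ring
end RankAux

open scoped BigOperators
open Filter MeasureTheory

namespace RankAux

/-- The integrand on the circle. -/
noncomputable def gg (t : ℝ) (n : ℕ) (θ : ℝ) : ℂ :=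
  FF (Complex.exp (-(t + θ * Complex.I))) * Complex.exp (n * θ * Complex.I)

lemma gg_norm (t : ℝ) (n : ℕ) (θ : ℝ) : ‖gg t n θ‖ = ‖FF (Complex.exp (-(t + θ * Complex.I)))‖ := by
  unfold gg
  rw [norm_mul, show (n * θ * Complex.I : ℂ) = ((n * θ : ℝ) : ℂ) * Complex.I by push_cast; ring,
    Complex.norm_exp_ofReal_mul_I, mul_one]

lemma exp_lt_one' (t : ℝ) (ht : 0 < t) : Real.exp (-t) < 1 := by simpa using ht

lemma norm_q (t θ : ℝ) : ‖Complex.exp (-(t + θ * Complex.I))‖ = Real.exp (-t) := by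
  rw [Complex.norm_exp]; simp

lemma gg_cont (t : ℝ) (ht : 0 < t) (n : ℕ) : Continuous (gg t n) := by
  unfold gg FF
  apply Continuous.mul
  · apply continuous_tsum (u := fun m => (oc m : ℝ) * (Real.exp (-t))^m)
    · intro i; fun_prop
    · exact oc_summable _ (Real.exp_pos _).le (exp_lt_one' t ht)
    · intro m θ
      rw [norm_mul, norm_pow, norm_q]; simp
  · fun_prop

lemma orth (k : ℤ) (hk : k ≠ 0) : ∫ θ in (-Real.pi)..Real.pi, Complex.exp (k * Complex.I * θ) = 0 := by
  have hc : (k * Complex.I : ℂ) ≠ 0 := mul_ne_zero (by exact_mod_cast hk) Complex.I_ne_zero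
  rw [integral_exp_mul_complex hc]
  have : Complex.exp (k * Complex.I * Real.pi) = Complex.exp (k * Complex.I * ((-Real.pi : ℝ) : ℂ)) := by
    rw [Complex.exp_eq_exp_iff_exists_int]
    exact ⟨k, by push_cast; ring⟩
  rw [this]; simp

lemma gg_integral (t : ℝ) (ht : 0 < t) (n : ℕ) :
    ∫ θ in (-Real.pi)..Real.pi, gg t n θ = ((oc n : ℝ) * Real.exp (-(n*t)) * (2 * Real.pi) : ℝ) := by
  have key : HasSum (fun m : ℕ => ∫ θ in (-Real.pi)..Real.pi,
      ((oc m : ℂ) * Complex.exp (-(t + θ * Complex.I))^m) * Complex.exp (n * θ * Complex.I))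
      (∫ θ in (-Real.pi)..Real.pi, gg t n θ) := by
    apply intervalIntegral.hasSum_integral_of_dominated_convergence
      (fun m _ => (oc m : ℝ) * (Real.exp (-t))^m)
    · intro m
      apply Continuous.aestronglyMeasurable
      fun_prop
    · intro m
      refine ae_of_all _ (fun θ _ => ?_)
      rw [norm_mul, norm_mul, norm_pow, norm_q,
        show (n * θ * Complex.I : ℂ) = ((n * θ : ℝ) : ℂ) * Complex.I by push_cast; ring,
        Complex.norm_exp_ofReal_mul_I]; simp
    · exact ae_of_all _ (fun θ _ => oc_summable _ (Real.exp_pos _).le (exp_lt_one' t ht))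
    · exact intervalIntegrable_const
    · refine ae_of_all _ (fun θ _ => ?_)
      unfold gg
      exact (FF_summable _ (by rw [norm_q]; exact exp_lt_one' t ht)).hasSum.mul_right _
  have e : ∀ m : ℕ, m ≠ n → ∫ θ in (-Real.pi)..Real.pi,
      ((oc m : ℂ) * Complex.exp (-(t + θ * Complex.I))^m) * Complex.exp (n * θ * Complex.I) = 0 := by
    intro m hm
    have : ∀ θ : ℝ, ((oc m : ℂ) * Complex.exp (-(t + θ * Complex.I))^m) * Complex.exp (n * θ * Complex.I)
      = ((oc m : ℂ) * Complex.exp (-(m*t))) * Complex.exp ((((n:ℤ)-m : ℤ) : ℂ) * Complex.I * θ) := by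
      intro θ
      rw [← Complex.exp_nat_mul, mul_assoc, mul_assoc (oc m : ℂ) (Complex.exp (-(m*t))), ← Complex.exp_add, ← Complex.exp_add]
      congr 2; push_cast; ring
    simp only [this]
    rw [intervalIntegral.integral_const_mul, orth _ (by omega), mul_zero]
  have h2 := hasSum_single n e
  rw [key.unique h2]
  have : ∀ θ : ℝ, ((oc n : ℂ) * Complex.exp (-(t + θ * Complex.I))^n) * Complex.exp (n * θ * Complex.I)
      = ((oc n : ℂ) * Complex.exp (-(n*t))) := by
    intro θ
    rw [← Complex.exp_nat_mul, mul_assoc, ← Complex.exp_add]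
    congr 2; ring
  simp only [this]
  rw [intervalIntegral.integral_const]
  simp only [Complex.real_smul]
  push_cast; ring

lemma sqrt_norm (z : ℂ) : ‖z ^ (1/2 : ℂ)‖ = Real.sqrt ‖z‖ := by
  have := Complex.norm_cpow_real z (1/2)
  push_cast at this
  rw [this, Real.sqrt_eq_rpow]

lemma FF_bound (z : ℂ) (hz : 0 < z.re) (h1 : 1 ≤ (Real.pi^2 / z).re) :
    ‖FF (Complex.exp (-z))‖ ≤ Real.sqrt ‖z‖ * Real.exp ((Real.pi^2 / z).re / 4) := by
  have h := FF_EE z hz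
  have h2 := EE_norm_ge _ h1
  have h3 : ‖FF (Complex.exp (-z))‖ ≤ ‖FF (Complex.exp (-z)) * EE (Real.pi^2 / z)‖ := by
    rw [norm_mul]; exact le_mul_of_one_le_right (norm_nonneg _) h2
  rw [h, norm_mul, sqrt_norm, Complex.norm_exp] at h3
  refine h3.trans ?_
  have e : (Real.pi^2 / (4 * z) : ℂ).re = (Real.pi^2 / z).re / 4 := by
    rw [show (Real.pi^2 / (4 * z) : ℂ) = (Real.pi^2 / z) / ((4:ℝ) : ℂ) by push_cast; field_simp,
      Complex.div_ofReal_re]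
  rw [e]
  apply mul_le_mul_of_nonneg_right _ (Real.exp_pos _).le
  apply Real.sqrt_le_sqrt
  rw [norm_div, Complex.norm_real, Real.norm_eq_abs, abs_of_pos Real.pi_pos]
  apply div_le_self (norm_nonneg _)
  linarith [Real.pi_gt_three]

lemma re_div (t θ : ℝ) : (Real.pi^2 / (t + θ * Complex.I) : ℂ).re = Real.pi^2 * t / (t^2 + θ^2) := by
  have : (Real.pi^2 : ℂ) = ((Real.pi^2 : ℝ) : ℂ) := by push_cast; rfl
  rw [this, div_eq_inv_mul, Complex.re_mul_ofReal, Complex.inv_re, Complex.normSq_add_mul_I]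
  simp; ring

lemma minor_bound (t θ : ℝ) (n : ℕ) (l : ℝ) (ht : 0 < t) (ht' : t ≤ 1/4) (hl : l = Real.pi^2/(4*t))
    (hn : (n:ℝ) * (4 * t^2) = Real.pi^2) (hθ : |θ| ≤ Real.pi) (hθt : t ≤ |θ|) :
    n * Real.exp (-l) * ‖gg t n θ‖ ≤ 4 * n * Real.exp (-l/2) + 1024 * Real.sqrt t := by
  rw [gg_norm]
  have hpi := Real.pi_gt_three
  have hpi4 := Real.pi_le_four
  have hp9 : 9 * t ≤ Real.pi^2 * t := by
    apply mul_le_mul_of_nonneg_right _ ht.le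
    nlinarith
  have htt : t^2 ≤ t := by nlinarith
  have hθ2 : t^2 ≤ θ^2 := by rw [← sq_abs θ]; gcongr
  have hpos : 0 < t^2 + θ^2 := by positivity
  have hz : 0 < (t + θ * Complex.I : ℂ).re := by simpa using ht
  by_cases hc : 1 ≤ (Real.pi^2 / (t + θ * Complex.I) : ℂ).re
  · have h := FF_bound _ hz hc
    have h1 : Real.sqrt ‖(t + θ * Complex.I : ℂ)‖ ≤ 4 := by
      rw [Real.sqrt_le_left (by norm_num)]
      refine (norm_add_le _ _).trans ?_
      rw [norm_mul, Complex.norm_real, Complex.norm_real, Complex.norm_I, Real.norm_eq_abs,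
        Real.norm_eq_abs, abs_of_pos ht]
      linarith
    have h2 : (Real.pi^2 / (t + θ * Complex.I) : ℂ).re / 4 ≤ l/2 := by
      rw [re_div, hl]
      rw [div_div, div_div, div_le_div_iff₀ (by positivity) (by positivity)]
      nlinarith [mul_nonneg (sq_nonneg Real.pi) (by linarith : 0 ≤ θ^2 - t^2)]
    calc n * Real.exp (-l) * ‖FF (Complex.exp (-(t + θ * Complex.I)))‖
        ≤ n * Real.exp (-l) * (4 * Real.exp (l/2)) := by
          gcongr
          refine h.trans ?_
          gcongr
      _ = 4 * n * (Real.exp (-l) * Real.exp (l/2)) := by ring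
      _ = 4 * n * Real.exp (-l/2) := by rw [← Real.exp_add]; ring_nf
      _ ≤ _ := by linarith [Real.sqrt_nonneg t]
  · push Not at hc
    rw [re_div, div_lt_one hpos] at hc
    have h1 := minor_aux t θ ht ht' hθ (by nlinarith)
    have h2 := FF_bound (t:ℂ) (by simpa using ht) (by
      have := re_div t 0
      simp only [Complex.ofReal_zero, zero_mul, add_zero] at this
      rw [this, le_div_iff₀ (by positivity)]
      nlinarith)
    have h3 : (Real.pi^2 / (t:ℂ)).re / 4 = l := by
      have := re_div t 0
      simp only [Complex.ofReal_zero, zero_mul, add_zero] at this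
      rw [this, hl]; field_simp
      norm_num
    rw [h3, Complex.norm_real, Real.norm_eq_abs, abs_of_pos ht] at h2
    calc n * Real.exp (-l) * ‖FF (Complex.exp (-(t + θ * Complex.I)))‖
        ≤ n * Real.exp (-l) * (256 * t^2 * (Real.sqrt t * Real.exp l)) := by
          gcongr
          refine h1.trans ?_
          gcongr
      _ = 64 * (n * (4 * t^2)) * Real.sqrt t * (Real.exp (-l) * Real.exp l) := by ring
      _ = 64 * Real.pi^2 * Real.sqrt t := by rw [← Real.exp_add, hn]; simp
      _ ≤ 1024 * Real.sqrt t := by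
          gcongr
          nlinarith
      _ ≤ _ := by
          have := Real.exp_pos (-l/2)
          have : (0:ℝ) ≤ 4 * n * Real.exp (-l/2) := by positivity
          linarith
end RankAux

open scoped BigOperators
open Filter MeasureTheory

namespace RankAux

lemma cpow_half_mul (r : ℝ) (hr : 0 < r) (w : ℂ) (hw : w ≠ 0) :
    ((r : ℂ) * w) ^ (1/2 : ℂ) = (Real.sqrt r : ℂ) * w ^ (1/2 : ℂ) := by
  have hr' : (r:ℂ) ≠ 0 := by exact_mod_cast hr.ne'
  rw [Complex.cpow_def_of_ne_zero (mul_ne_zero hr' hw), Complex.cpow_def_of_ne_zero hw,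
    Complex.log_ofReal_mul hr hw, add_mul, Complex.exp_add]
  congr 1
  rw [Real.sqrt_eq_rpow, Real.rpow_def_of_pos hr]
  push_cast; rfl

lemma one_add_ne (u : ℝ) : (1 + u * Complex.I : ℂ) ≠ 0 := by
  intro h
  have := congrArg Complex.re h
  simp at this

lemma major_pt (n : ℕ) (t l s u v : ℝ) (ht : 0 < t) (hs : 0 < s) (hl : l = s^2) (hlt : l * (4*t) = Real.pi^2)
    (hn : n * t = l) (hu : u * s = v) :
    ((s * Real.exp (-l) : ℝ) : ℂ) * gg t n (t * u) * EE (4 * l / (1 + u * Complex.I)) =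
      (Real.sqrt Real.pi / 2 : ℝ) * (1 + u * Complex.I) ^ (1/2 : ℂ) * Complex.exp (-v^2 / (1 + u * Complex.I)) := by
  have hw := one_add_ne u
  have hpi : (Real.pi : ℂ) ≠ 0 := by exact_mod_cast Real.pi_ne_zero
  have htC : (t : ℂ) ≠ 0 := by exact_mod_cast ht.ne'
  have hltC : (l:ℂ) * (4*t) = Real.pi^2 := by exact_mod_cast hlt
  have hnC : (n:ℂ) * t = l := by exact_mod_cast hn
  have huC : (u:ℂ) * s = v := by exact_mod_cast hu
  have hlC : (l:ℂ) = s^2 := by exact_mod_cast hl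
  set z : ℂ := t * (1 + u * Complex.I) with hz
  have hzre : 0 < z.re := by
    have : z.re = t := by simp [hz]
    rw [this]; exact ht
  have h := FF_EE z hzre
  have e1 : Real.pi^2 / z = 4 * l / (1 + u * Complex.I) := by
    rw [hz, ← hltC]; field_simp
  have e2 : z / Real.pi = ((t / Real.pi : ℝ) : ℂ) * (1 + u * Complex.I) := by
    rw [hz]; push_cast; ring
  have e3 : (Real.pi^2 / (4*z) : ℂ) = l / (1 + u * Complex.I) := by
    rw [hz, ← hltC]; field_simp
  have e4 : Real.sqrt (t / Real.pi) * s = Real.sqrt Real.pi / 2 := by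
    have : t / Real.pi = Real.pi / (2*s)^2 := by
      have := Real.pi_pos
      field_simp; nlinarith
    rw [this, Real.sqrt_div Real.pi_pos.le, Real.sqrt_sq (by positivity)]
    field_simp
  rw [e1, e2, e3, cpow_half_mul _ (div_pos ht Real.pi_pos) _ hw] at h
  have hzz : Complex.exp (-z) = Complex.exp (-(t + ((t*u : ℝ):ℂ) * Complex.I)) := by
    congr 1; rw [hz]; push_cast; ring
  rw [hzz] at h
  have e5 : ((Real.exp (-l) : ℝ) : ℂ) * Complex.exp (n * ((t*u : ℝ) : ℂ) * Complex.I) * Complex.exp (l / (1 + u * Complex.I))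
      = Complex.exp (-v^2 / (1 + u * Complex.I)) := by
    rw [Complex.ofReal_exp, ← Complex.exp_add, ← Complex.exp_add]
    congr 1
    push_cast
    have : (v:ℂ)^2 = u^2 * l := by rw [← huC, hlC]; ring
    rw [this]
    field_simp
    rw [← hnC]
    linear_combination (n * t * u^2) * Complex.I_sq
  rw [← e5, ← e4]
  unfold gg
  push_cast at h ⊢
  linear_combination ((s:ℂ) * Complex.exp (-l) * Complex.exp (n * (t*u) * Complex.I)) * h

lemma re_div' (l u : ℝ) : (4 * l / (1 + u * Complex.I) : ℂ).re = 4 * l / (1 + u^2) := by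
  have : (4 * l / (1 + u * Complex.I) : ℂ) = ((4 * l : ℝ) : ℂ) / ((1:ℝ) + u * Complex.I) := by push_cast; rfl
  rw [this, div_eq_inv_mul, Complex.re_mul_ofReal, Complex.inv_re, Complex.normSq_add_mul_I]
  simp; ring

lemma re_div'' (v u : ℝ) : (-v^2 / (1 + u * Complex.I) : ℂ).re = -v^2 / (1 + u^2) := by
  have : (-v^2 / (1 + u * Complex.I) : ℂ) = ((-v^2 : ℝ) : ℂ) / ((1:ℝ) + u * Complex.I) := by push_cast; rfl
  rw [this, div_eq_inv_mul, Complex.re_mul_ofReal, Complex.inv_re, Complex.normSq_add_mul_I]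
  simp; ring

lemma major_bound (n : ℕ) (t l s u v : ℝ) (ht : 0 < t) (hs : 0 < s) (hl : l = s^2) (hlt : l * (4*t) = Real.pi^2)
    (hn : n * t = l) (hu : u * s = v) (hu1 : |u| ≤ 1) (hl1 : 1 ≤ l) :
    ‖((s * Real.exp (-l) : ℝ) : ℂ) * gg t n (t * u)‖ ≤ 2 * Real.exp (-(1/2) * v^2) := by
  have hu2 : u^2 ≤ 1 := by rw [← sq_abs]; nlinarith [abs_nonneg u]
  have h := major_pt n t l s u v ht hs hl hlt hn hu
  have hE := EE_norm_ge (4 * l / (1 + u * Complex.I)) (by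
    rw [re_div', le_div_iff₀ (by positivity)]; nlinarith)
  refine le_trans (le_mul_of_one_le_right (norm_nonneg _) hE) ?_
  rw [← norm_mul, h, norm_mul, norm_mul, sqrt_norm, Complex.norm_exp, re_div'']
  apply mul_le_mul _ _ (Real.exp_pos _).le (by norm_num)
  · rw [Complex.norm_real, Real.norm_eq_abs, abs_of_nonneg (by positivity)]
    have h1 : Real.sqrt Real.pi ≤ 2 := by
      rw [Real.sqrt_le_left (by norm_num)]; linarith [Real.pi_le_four]
    have h2 : Real.sqrt ‖(1 + u * Complex.I : ℂ)‖ ≤ 2 := by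
      rw [Real.sqrt_le_left (by norm_num)]
      refine (norm_add_le _ _).trans ?_
      rw [norm_mul, Complex.norm_real, Complex.norm_I, Real.norm_eq_abs, norm_one]
      linarith
    have h3 := Real.sqrt_nonneg Real.pi
    have h4 := Real.sqrt_nonneg ‖(1 + u * Complex.I : ℂ)‖
    nlinarith
  · apply Real.exp_le_exp.2
    rw [div_le_iff₀ (by positivity)]
    nlinarith [mul_nonneg (sq_nonneg v) (by linarith : 0 ≤ 1 - u^2)]

/-- parameters -/
noncomputable def ll (n : ℕ) : ℝ := Real.pi * Real.sqrt n / 2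
noncomputable def tt (n : ℕ) : ℝ := Real.pi / (2 * Real.sqrt n)
noncomputable def ss (n : ℕ) : ℝ := Real.sqrt (ll n)

lemma params (n : ℕ) (hn : 0 < n) : 0 < tt n ∧ 0 < ss n ∧ ll n = (ss n)^2 ∧
    ll n * (4 * tt n) = Real.pi^2 ∧ n * tt n = ll n ∧ 1 ≤ ll n := by
  have h1 : 1 ≤ Real.sqrt n := by
    rw [Real.one_le_sqrt]; exact_mod_cast hn
  have h0 : 0 < Real.sqrt n := by linarith
  have hpi := Real.pi_gt_three
  have hl : 1 ≤ ll n := by unfold ll; nlinarith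
  refine ⟨by unfold tt; positivity, by unfold ss; exact Real.sqrt_pos.2 (by linarith), ?_, ?_, ?_, hl⟩
  · unfold ss; rw [Real.sq_sqrt (by linarith)]
  · unfold ll tt; field_simp; norm_num
  · unfold ll tt
    have : Real.sqrt n * Real.sqrt n = n := Real.mul_self_sqrt (Nat.cast_nonneg n)
    field_simp
    linarith

lemma ll_tendsto : Tendsto ll atTop atTop := by
  unfold ll
  have h : Tendsto (fun n : ℕ => Real.sqrt n) atTop atTop :=
    Real.tendsto_sqrt_atTop.comp tendsto_natCast_atTop_atTop
  exact (h.const_mul_atTop Real.pi_pos).atTop_div_const (by norm_num)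

lemma ss_tendsto : Tendsto ss atTop atTop := Real.tendsto_sqrt_atTop.comp ll_tendsto

lemma tt_tendsto : Tendsto tt atTop (nhds 0) := by
  unfold tt
  have h : Tendsto (fun n : ℕ => Real.sqrt n) atTop atTop :=
    Real.tendsto_sqrt_atTop.comp tendsto_natCast_atTop_atTop
  exact tendsto_const_nhds.div_atTop (h.const_mul_atTop (by norm_num))

lemma major_lim (v : ℝ) : Tendsto (fun n : ℕ => ((ss n * Real.exp (-ll n) : ℝ) : ℂ) * gg (tt n) n (tt n * (v / ss n)))
    atTop (nhds ((Real.sqrt Real.pi / 4 * Real.exp (-v^2) : ℝ) : ℂ)) := by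
  have hu : Tendsto (fun n => v / ss n) atTop (nhds 0) := tendsto_const_nhds.div_atTop ss_tendsto
  have hw : Tendsto (fun n => (1 + ((v / ss n : ℝ) : ℂ) * Complex.I)) atTop (nhds 1) := by
    have : Tendsto (fun n => (1 + ((v / ss n : ℝ) : ℂ) * Complex.I)) atTop (nhds (1 + ((0:ℝ):ℂ) * Complex.I)) :=
      ((Complex.continuous_ofReal.tendsto 0).comp hu).mul_const _ |>.const_add 1
    simpa using this
  have hE : Tendsto (fun n => EE (4 * ll n / (1 + ((v / ss n : ℝ) : ℂ) * Complex.I))) atTop (nhds 2) := by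
    rw [tendsto_iff_norm_sub_tendsto_zero]
    have hb : Tendsto (fun n => 4 * Real.exp (-ll n)) atTop (nhds 0) := by
      have := (Real.tendsto_exp_neg_atTop_nhds_zero.comp ll_tendsto).const_mul 4
      simpa using this
    refine squeeze_zero' (Eventually.of_forall fun _ => norm_nonneg _) ?_ hb
    filter_upwards [hu.eventually (Metric.ball_mem_nhds 0 one_pos), eventually_gt_atTop 0] with n hn hn0
    obtain ⟨_, _, _, _, _, h1⟩ := params n hn0
    simp only [Real.dist_eq, sub_zero, Metric.mem_ball] at hn
    have hu2 : (v / ss n)^2 ≤ 1 := by rw [← sq_abs]; nlinarith [abs_nonneg (v / ss n)]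
    have h2 : ll n ≤ (4 * ll n / (1 + ((v / ss n : ℝ) : ℂ) * Complex.I) : ℂ).re := by
      rw [re_div', le_div_iff₀ (by positivity)]; nlinarith
    refine (EE_bound _ (h1.trans h2)).trans ?_
    gcongr
    linarith
  have hR : Tendsto (fun n => ((Real.sqrt Real.pi / 2 : ℝ) : ℂ) * (1 + ((v / ss n : ℝ) : ℂ) * Complex.I) ^ (1/2 : ℂ) *
      Complex.exp (-v^2 / (1 + ((v / ss n : ℝ) : ℂ) * Complex.I)) / EE (4 * ll n / (1 + ((v / ss n : ℝ) : ℂ) * Complex.I)))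
      atTop (nhds (((Real.sqrt Real.pi / 2 : ℝ) : ℂ) * (1:ℂ) ^ (1/2 : ℂ) * Complex.exp (-v^2 / 1) / 2)) := by
    refine Tendsto.div (Tendsto.mul (Tendsto.const_mul _ ?_) ?_) hE two_ne_zero
    · exact (continuousAt_cpow_const (by simp)).tendsto.comp hw
    · exact (Complex.continuous_exp.tendsto _).comp (tendsto_const_nhds.div hw one_ne_zero)
  have e : ((Real.sqrt Real.pi / 4 * Real.exp (-v^2) : ℝ) : ℂ) =
    (((Real.sqrt Real.pi / 2 : ℝ) : ℂ) * (1:ℂ) ^ (1/2 : ℂ) * Complex.exp (-v^2 / 1) / 2) := by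
    rw [Complex.one_cpow]; push_cast; rw [div_one]; ring
  rw [e]
  refine hR.congr' ?_
  filter_upwards [hE.eventually_ne two_ne_zero, eventually_gt_atTop 0] with n hn hn0
  obtain ⟨h1, h2, h3, h4, h5, h6⟩ := params n hn0
  rw [← major_pt n (tt n) (ll n) (ss n) (v / ss n) v h1 h2 h3 h4 h5 (by field_simp)]
  field_simp

lemma major_int : Tendsto (fun n : ℕ => ∫ v in (-ss n)..(ss n),
    ((ss n * Real.exp (-ll n) : ℝ) : ℂ) * gg (tt n) n (tt n * (v / ss n)))
    atTop (nhds ((Real.pi / 4 : ℝ) : ℂ)) := by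
  have hlim : ((Real.pi / 4 : ℝ) : ℂ) = ∫ v : ℝ, ((Real.sqrt Real.pi / 4 * Real.exp (-v^2) : ℝ) : ℂ) := by
    rw [integral_complex_ofReal, integral_const_mul]
    have := integral_gaussian 1
    simp only [neg_mul, one_mul, div_one] at this
    rw [this]
    congr 1
    have := Real.mul_self_sqrt Real.pi_pos.le
    linarith
  rw [hlim]
  have e : ∀ᶠ n in atTop, (∫ v : ℝ, (Set.Ioc (-ss n) (ss n)).indicator (fun v : ℝ =>
    ((ss n * Real.exp (-ll n) : ℝ) : ℂ) * gg (tt n) n (tt n * (v / ss n))) v) =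
    ∫ v in (-ss n)..(ss n),
    ((ss n * Real.exp (-ll n) : ℝ) : ℂ) * gg (tt n) n (tt n * (v / ss n)) := by
    filter_upwards [eventually_gt_atTop 0] with n hn0
    obtain ⟨h1, h2, h3, h4, h5, h6⟩ := params n hn0
    rw [intervalIntegral.integral_of_le (by linarith), integral_indicator measurableSet_Ioc]
  refine Tendsto.congr' e ?_
  refine tendsto_integral_filter_of_dominated_convergence (fun v => 2 * Real.exp (-(1/2) * v^2)) ?_ ?_ ?_ ?_
  · filter_upwards [eventually_gt_atTop 0] with n hn0
    obtain ⟨h1, h2, h3, h4, h5, h6⟩ := params n hn0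
    refine AEStronglyMeasurable.indicator ?_ measurableSet_Ioc
    apply Continuous.aestronglyMeasurable
    exact continuous_const.mul ((gg_cont _ h1 n).comp (by fun_prop))
  · filter_upwards [eventually_gt_atTop 0] with n hn0
    refine ae_of_all _ (fun v => ?_)
    obtain ⟨h1, h2, h3, h4, h5, h6⟩ := params n hn0
    by_cases hv : v ∈ Set.Ioc (-ss n) (ss n)
    · rw [Set.indicator_of_mem hv]
      refine major_bound n (tt n) (ll n) (ss n) (v / ss n) v h1 h2 h3 h4 h5 (by field_simp) ?_ h6
      rw [abs_div, abs_of_pos h2, div_le_one h2, abs_le]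
      exact ⟨hv.1.le, hv.2⟩
    · rw [Set.indicator_of_notMem hv]; simp; positivity
  · exact (integrable_exp_neg_mul_sq (by norm_num)).const_mul 2
  · refine ae_of_all _ (fun v => ?_)
    refine (major_lim v).congr' ?_
    filter_upwards [ss_tendsto.eventually_gt_atTop |v|] with n hn
    rw [Set.indicator_of_mem]
    rw [abs_lt] at hn
    exact ⟨hn.1, hn.2.le⟩
end RankAux

open scoped BigOperators
open Filter MeasureTheory

namespace RankAux

lemma major_eq (n : ℕ) (hn : 0 < n) : ((n * Real.exp (-ll n) : ℝ) : ℂ) * ∫ θ in (-tt n)..(tt n), gg (tt n) n θ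
    = ∫ v in (-ss n)..(ss n),
    ((ss n * Real.exp (-ll n) : ℝ) : ℂ) * gg (tt n) n (tt n * (v / ss n)) := by
  obtain ⟨h1, h2, h3, h4, h5, h6⟩ := params n hn
  rw [intervalIntegral.integral_const_mul]
  have h := intervalIntegral.smul_integral_comp_mul_left (a := -ss n) (b := ss n) (gg (tt n) n) (tt n / ss n)
  have e1 : tt n / ss n * ss n = tt n := by field_simp
  rw [mul_neg, e1] at h
  rw [← h]
  have e2 : ∀ v : ℝ, tt n / ss n * v = tt n * (v / ss n) := fun v => by ring
  simp only [e2, Complex.real_smul]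
  rw [← mul_assoc, ← Complex.ofReal_mul]
  congr 2
  have : n * tt n / ss n = ss n := by rw [h5, h3]; field_simp
  calc n * Real.exp (-ll n) * (tt n / ss n) = (n * tt n / ss n) * Real.exp (-ll n) := by ring
    _ = _ := by rw [this]

lemma eps_tendsto : Tendsto (fun n : ℕ => 4 * n * Real.exp (-ll n/2) + 1024 * Real.sqrt (tt n)) atTop (nhds 0) := by
  have h1 : Tendsto (fun n => 1024 * Real.sqrt (tt n)) atTop (nhds 0) := by
    have := ((Real.continuous_sqrt.tendsto 0).comp tt_tendsto).const_mul 1024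
    simpa using this
  have h2 : Tendsto (fun n : ℕ => 4 * n * Real.exp (-ll n/2)) atTop (nhds 0) := by
    have h := ((Real.tendsto_pow_mul_exp_neg_atTop_nhds_zero 2).comp
      (ll_tendsto.atTop_div_const (by norm_num : (0:ℝ) < 2))).const_mul (64/Real.pi^2)
    rw [mul_zero] at h
    refine h.congr (fun n => ?_)
    simp only [Function.comp]
    have : (n:ℝ) = Real.sqrt n ^ 2 := (Real.sq_sqrt (Nat.cast_nonneg n)).symm
    have h3 : (ll n / 2)^2 = Real.pi^2 * n / 16 := by
      unfold ll; rw [this, Real.sqrt_sq (Real.sqrt_nonneg _)]; ring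
    rw [h3, neg_div]
    have := Real.pi_pos
    field_simp
    ring
  simpa using h2.add h1

lemma oc_asymp : Tendsto (fun n : ℕ => (oc n : ℝ) * n * Real.exp (-(Real.pi * Real.sqrt n))) atTop (nhds (1/8)) := by
  have hM : Tendsto (fun n : ℕ => ((n * Real.exp (-ll n) : ℝ) : ℂ) * ∫ θ in (-tt n)..(tt n), gg (tt n) n θ)
      atTop (nhds ((Real.pi / 4 : ℝ) : ℂ)) := by
    refine major_int.congr' ?_
    filter_upwards [eventually_gt_atTop 0] with n hn
    exact (major_eq n hn).symm
  have htsmall : ∀ᶠ n in atTop, tt n ≤ 1/4 := tt_tendsto.eventually_le_const (by norm_num)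
  have hR : ∀ (a b : ℕ → ℝ), (∀ᶠ n in atTop, |b n - a n| ≤ Real.pi ∧ ∀ θ ∈ Set.uIoc (a n) (b n), |θ| ≤ Real.pi ∧ tt n ≤ |θ|) →
      Tendsto (fun n : ℕ => ((n * Real.exp (-ll n) : ℝ) : ℂ) * ∫ θ in (a n)..(b n), gg (tt n) n θ) atTop (nhds 0) := by
    intro a b hab
    rw [tendsto_zero_iff_norm_tendsto_zero]
    refine squeeze_zero' (Eventually.of_forall fun _ => norm_nonneg _) ?_ (by simpa using eps_tendsto.mul_const Real.pi)
    filter_upwards [hab, eventually_gt_atTop 0, htsmall] with n hn hn0 hts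
    obtain ⟨h1, h2, h3, h4, h5, h6⟩ := params n hn0
    rw [← intervalIntegral.integral_const_mul]
    have hle := intervalIntegral.norm_integral_le_of_norm_le_const (a := a n) (b := b n)
      (f := fun θ => ((n * Real.exp (-ll n) : ℝ) : ℂ) * gg (tt n) n θ)
      (C := 4 * n * Real.exp (-ll n/2) + 1024 * Real.sqrt (tt n)) (by
        intro θ hθ
        obtain ⟨g1, g2⟩ := hn.2 θ hθ
        rw [norm_mul, Complex.norm_real, Real.norm_eq_abs, abs_of_nonneg (by positivity)]
        refine minor_bound (tt n) θ n (ll n) h1 hts ?_ ?_ g1 g2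
        · rw [← h4]; field_simp
        · rw [← h4, ← h5]; ring)
    refine hle.trans ?_
    apply mul_le_mul_of_nonneg_left hn.1 (by positivity)
  have hpi := Real.pi_gt_three
  have hR1 := hR (fun n => -Real.pi) (fun n => -tt n) (by
    filter_upwards [htsmall, eventually_gt_atTop 0] with n hn hn0
    obtain ⟨h1, h2, h3, h4, h5, h6⟩ := params n hn0
    refine ⟨?_, ?_⟩
    · rw [abs_le]; constructor <;> linarith
    · intro θ hθ
      rw [Set.uIoc_of_le (by linarith)] at hθ
      have := hθ.1
      have := hθ.2
      rw [abs_of_nonpos (by linarith)]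
      constructor <;> linarith)
  have hR2 := hR (fun n => tt n) (fun n => Real.pi) (by
    filter_upwards [htsmall, eventually_gt_atTop 0] with n hn hn0
    obtain ⟨h1, h2, h3, h4, h5, h6⟩ := params n hn0
    refine ⟨?_, ?_⟩
    · rw [abs_le]; constructor <;> linarith
    · intro θ hθ
      rw [Set.uIoc_of_le (by linarith)] at hθ
      have := hθ.1
      have := hθ.2
      rw [abs_of_nonneg (by linarith)]
      constructor <;> linarith)
  have hT := (hR1.add hM).add hR2
  rw [zero_add, add_zero] at hT
  have hT2 : Tendsto (fun n : ℕ => (((oc n : ℝ) * n * Real.exp (-(Real.pi * Real.sqrt n)) * (2*Real.pi) : ℝ) : ℂ)) atTop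
      (nhds ((Real.pi / 4 : ℝ) : ℂ)) := by
    refine hT.congr' ?_
    filter_upwards [eventually_gt_atTop 0] with n hn0
    obtain ⟨h1, h2, h3, h4, h5, h6⟩ := params n hn0
    have hi : ∀ a b, IntervalIntegrable (gg (tt n) n) volume a b := fun a b =>
      (gg_cont _ h1 n).intervalIntegrable a b
    rw [← mul_add, ← mul_add, intervalIntegral.integral_add_adjacent_intervals (hi _ _) (hi _ _),
      intervalIntegral.integral_add_adjacent_intervals (hi _ _) (hi _ _), gg_integral _ h1, h5,
      ← Complex.ofReal_mul]
    congr 1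
    have : Real.exp (-(Real.pi * Real.sqrt n)) = Real.exp (-ll n) * Real.exp (-ll n) := by
      rw [← Real.exp_add]; unfold ll; congr 1; ring
    rw [this]; ring
  have hT3 := (Complex.continuous_re.tendsto _).comp hT2
  simp only [Function.comp_def, Complex.ofReal_re] at hT3
  have hT4 := hT3.div_const (2*Real.pi)
  have e : Real.pi / 4 / (2*Real.pi) = 1/8 := by field_simp; norm_num
  rw [e] at hT4
  refine hT4.congr (fun n => ?_)
  field_simp
end RankAux

open scoped BigOperators
open Filter MeasureTheory

namespace RankAux

lemma oc_upper : ∃ C : ℝ, 0 < C ∧ ∀ n : ℕ, (oc n : ℝ) * (n+1) ≤ C * Real.exp (Real.pi * Real.sqrt n) := by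
  have h0 : Tendsto (fun n : ℕ => (oc n : ℝ) * n * Real.exp (-(Real.pi * Real.sqrt n))) atTop (nhds (1/8)) := oc_asymp
  obtain ⟨C, hC⟩ := h0.bddAbove_range
  have hC' : ∀ n : ℕ, (oc n : ℝ) * n * Real.exp (-(Real.pi * Real.sqrt n)) ≤ C := fun n => hC ⟨n, rfl⟩
  refine ⟨2 * |C| + 1, by positivity, fun n => ?_⟩
  rcases Nat.eq_zero_or_pos n with rfl | hn
  · simp [oc_zero]
  · have h1 := hC' n
    rw [Real.exp_neg, ← div_eq_mul_inv, div_le_iff₀ (Real.exp_pos _)] at h1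
    have h2 : (1:ℝ) ≤ n := by exact_mod_cast hn
    have h3 : (0:ℝ) ≤ oc n := Nat.cast_nonneg _
    have h4 := Real.exp_pos (Real.pi * Real.sqrt n)
    have h5 := le_abs_self C
    calc (oc n : ℝ) * (n+1) ≤ 2 * (oc n * n) := by nlinarith
      _ ≤ 2 * (C * Real.exp (Real.pi * Real.sqrt n)) := by linarith
      _ ≤ _ := by nlinarith

lemma oc_lower : ∀ᶠ n : ℕ in atTop, Real.exp (Real.pi * Real.sqrt n) ≤ 16 * ((oc n : ℝ) * n) := by
  filter_upwards [oc_asymp.eventually_const_le (by norm_num : (1/16:ℝ) < 1/8)] with n hn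
  rw [Real.exp_neg, ← div_eq_mul_inv, le_div_iff₀ (Real.exp_pos _)] at hn
  linarith

lemma oc_pos_ev : ∀ᶠ n : ℕ in atTop, (0:ℝ) < oc n := by
  filter_upwards [oc_lower, eventually_gt_atTop 0] with n hn h0
  have h1 := Real.exp_pos (Real.pi * Real.sqrt n)
  have h2 : (0:ℝ) < n := by exact_mod_cast h0
  by_contra h
  push Not at h
  nlinarith

lemma sqrt_sub_bound (N j : ℕ) (hj : j ≤ N) (hN : 0 < N) :
    Real.sqrt ((N - j : ℕ) : ℝ) ≤ Real.sqrt N - (j : ℝ) / Real.sqrt N / 2 := by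
  have hN' : (0:ℝ) < N := by exact_mod_cast hN
  have hs : 0 < Real.sqrt N := Real.sqrt_pos.2 hN'
  have hsq : Real.sqrt N * Real.sqrt N = N := Real.mul_self_sqrt hN'.le
  have hjN : (j:ℝ) ≤ N := by exact_mod_cast hj
  rw [Nat.cast_sub hj]
  have e : (j:ℝ) / Real.sqrt N * Real.sqrt N = j := by field_simp
  set a := (j:ℝ) / Real.sqrt N with ha
  have ha0 : 0 ≤ a := by positivity
  have hle : a ≤ Real.sqrt N := by
    rw [ha, div_le_iff₀ hs, hsq]; exact hjN
  rw [Real.sqrt_le_left (by linarith)]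
  nlinarith [sq_nonneg a]

lemma oz_bound : ∃ C : ℝ, 0 < C ∧ ∀ᶠ N : ℕ in atTop, ∀ j : ℕ,
    oz N j ≤ C * oc N * Real.exp (-(Real.pi/4) * (j / Real.sqrt N)) := by
  obtain ⟨C, hC, hup⟩ := oc_upper
  refine ⟨16 * C * 32, by positivity, ?_⟩
  filter_upwards [oc_lower, eventually_gt_atTop 0] with N hlow hN j
  unfold oz
  split_ifs with hj
  swap
  · positivity
  have hN' : (0:ℝ) < N := by exact_mod_cast hN
  have hN1 : (1:ℝ) ≤ N := by exact_mod_cast hN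
  have hs : 0 < Real.sqrt N := Real.sqrt_pos.2 hN'
  have hsq : Real.sqrt N * Real.sqrt N = N := Real.mul_self_sqrt hN'.le
  have hjN : (j:ℝ) ≤ N := by exact_mod_cast hj
  have h1 := hup (N - j)
  have h2 := sqrt_sub_bound N j hj hN
  set a := (j:ℝ) / Real.sqrt N with ha
  have ha0 : 0 ≤ a := by positivity
  have hpi := Real.pi_gt_three
  have h3 : Real.exp (Real.pi * Real.sqrt ((N-j : ℕ):ℝ)) ≤ Real.exp (Real.pi * Real.sqrt N) * Real.exp (-(Real.pi/4)*a) * Real.exp (-(Real.pi/4)*a) := by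
    rw [← Real.exp_add, ← Real.exp_add]
    apply Real.exp_le_exp.2
    nlinarith
  have h4 : (N:ℝ) * Real.exp (-(Real.pi/4)*a) ≤ 32 * (((N-j:ℕ):ℝ) + 1) := by
    rw [neg_mul, Real.exp_neg, ← div_eq_mul_inv, div_le_iff₀ (Real.exp_pos _), Nat.cast_sub hj]
    have hE1 : 1 ≤ Real.exp (Real.pi/4*a) := Real.one_le_exp (by positivity)
    by_cases hc : 2 * (j:ℝ) ≤ N
    · nlinarith
    · push Not at hc
      have h5 := Real.quadratic_le_exp_of_nonneg (x := Real.pi/4*a) (by positivity)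
      have h6 : Real.sqrt N / 2 ≤ a := by
        rw [ha, le_div_iff₀ hs]; nlinarith
      have h7 : 3/8 * Real.sqrt N ≤ Real.pi/4*a := by nlinarith
      have h8 : 9/64 * N ≤ (Real.pi/4*a)^2 := by
        have : (3/8 * Real.sqrt N)^2 ≤ (Real.pi/4*a)^2 := by gcongr
        nlinarith
      have h9 : (N:ℝ)/32 ≤ Real.exp (Real.pi/4*a) := by nlinarith
      have : (0:ℝ) ≤ N - j := by linarith
      nlinarith
  have hpos : (0:ℝ) < ((N-j:ℕ):ℝ) + 1 := by positivity
  refine le_of_mul_le_mul_right ?_ hpos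
  have hx : 0 < Real.exp (-(Real.pi/4)*a) := Real.exp_pos _
  calc (oc (N-j) : ℝ) * (((N-j:ℕ):ℝ)+1) ≤ C * Real.exp (Real.pi * Real.sqrt ((N-j : ℕ):ℝ)) := h1
    _ ≤ C * (Real.exp (Real.pi * Real.sqrt N) * Real.exp (-(Real.pi/4)*a) * Real.exp (-(Real.pi/4)*a)) := by gcongr
    _ ≤ C * ((16 * ((oc N : ℝ) * N)) * Real.exp (-(Real.pi/4)*a) * Real.exp (-(Real.pi/4)*a)) := by gcongr
    _ = C * 16 * oc N * Real.exp (-(Real.pi/4)*a) * (N * Real.exp (-(Real.pi/4)*a)) := by ring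
    _ ≤ C * 16 * oc N * Real.exp (-(Real.pi/4)*a) * (32 * (((N-j:ℕ):ℝ) + 1)) := by gcongr
    _ = _ := by ring

lemma sqrt_nat_tendsto : Tendsto (fun n : ℕ => Real.sqrt n) atTop atTop :=
    Real.tendsto_sqrt_atTop.comp tendsto_natCast_atTop_atTop

lemma oz_lim (j : ℕ → ℕ) (y : ℝ) (hj : Tendsto (fun N : ℕ => (j N : ℝ) / Real.sqrt N) atTop (nhds y)) :
    Tendsto (fun N : ℕ => oz N (j N) / oc N) atTop (nhds (Real.exp (-(Real.pi * y / 2)))) := by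
  have hjN : Tendsto (fun N : ℕ => (j N : ℝ) / N) atTop (nhds 0) := by
    have := hj.div_atTop sqrt_nat_tendsto
    refine this.congr (fun N => ?_)
    rw [div_div, Real.mul_self_sqrt (Nat.cast_nonneg N)]
  have hle : ∀ᶠ N : ℕ in atTop, 2 * j N ≤ N := by
    filter_upwards [hjN.eventually_le_const (by norm_num : (0:ℝ) < 1/2), eventually_gt_atTop 0] with N hN h0
    have : (0:ℝ) < N := by exact_mod_cast h0
    rw [div_le_iff₀ this] at hN
    have : (2 * j N : ℝ) ≤ N := by linarith
    exact_mod_cast this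
  have hinf : Tendsto (fun N => N - j N) atTop atTop := by
    rw [tendsto_atTop]
    intro b
    filter_upwards [hle, eventually_ge_atTop (2*b)] with N h1 h2
    omega
  have hA := (oc_asymp.comp hinf).div oc_asymp (by norm_num)
  have hr : Tendsto (fun N : ℕ => (1 - (j N : ℝ)/N)) atTop (nhds 1) := by
    simpa using hjN.const_sub 1
  have hB : Tendsto (fun N : ℕ => 1 / (1 - (j N : ℝ)/N)) atTop (nhds 1) := by
    simpa using hr.inv₀ one_ne_zero
  have hD : Tendsto (fun N : ℕ => Real.exp (-(Real.pi * (((j N : ℝ) / Real.sqrt N) / (1 + Real.sqrt (1 - (j N : ℝ)/N))))))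
      atTop (nhds (Real.exp (-(Real.pi * y / 2)))) := by
    have h1 := (Real.continuous_sqrt.tendsto 1).comp hr
    have h2 := hj.div (h1.const_add 1) (by simp)
    have h3 := (Real.continuous_exp.tendsto _).comp ((h2.const_mul Real.pi).neg)
    rw [show -(Real.pi * y / 2) = -(Real.pi * (y / (1 + Real.sqrt 1))) by rw [Real.sqrt_one]; ring]
    exact h3
  have hT := (hA.mul hB).mul hD
  have e : (1/8:ℝ) / (1/8) * 1 * Real.exp (-(Real.pi * y / 2)) = Real.exp (-(Real.pi * y / 2)) := by norm_num
  rw [e] at hT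
  refine hT.congr' ?_
  filter_upwards [hle, eventually_gt_atTop 0, oc_pos_ev] with N h1 h0 hpos
  have hN' : (0:ℝ) < N := by exact_mod_cast h0
  have hj2 : 2 * (j N : ℝ) ≤ N := by exact_mod_cast h1
  have hs : 0 < Real.sqrt N := Real.sqrt_pos.2 hN'
  have hsq : Real.sqrt N * Real.sqrt N = N := Real.mul_self_sqrt hN'.le
  have hjle : j N ≤ N := by omega
  have hcast : ((N - j N : ℕ) : ℝ) = N - j N := Nat.cast_sub hjle
  simp only [oz, if_pos hjle, Function.comp, Pi.div_apply]
  have hq : 0 ≤ 1 - (j N : ℝ)/N := by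
    rw [sub_nonneg, div_le_one hN']; exact_mod_cast hjle
  have hs2 : Real.sqrt ((N - j N : ℕ) : ℝ) = Real.sqrt N * Real.sqrt (1 - (j N : ℝ)/N) := by
    rw [← Real.sqrt_mul hN'.le, hcast]; congr 1; field_simp
  set R := Real.sqrt (1 - (j N : ℝ)/N) with hR
  have hR0 : 0 ≤ R := Real.sqrt_nonneg _
  have hRR : R * R = 1 - (j N : ℝ)/N := Real.mul_self_sqrt hq
  have e1 : ((j N : ℝ) / Real.sqrt N) / (1 + R) = Real.sqrt N - Real.sqrt N * R := by
    rw [div_eq_iff (by positivity)]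
    rw [div_eq_iff hs.ne']
    have : (j N : ℝ) = N * (1 - R * R) := by rw [hRR]; field_simp; ring
    rw [this]; linear_combination (-(1 - R * R)) * hsq
  have e2 : Real.exp (-(Real.pi * (Real.sqrt N - Real.sqrt N * R))) = Real.exp (-(Real.pi * Real.sqrt N)) * (Real.exp (-(Real.pi * (Real.sqrt N * R))))⁻¹ := by
    rw [← Real.exp_neg, ← Real.exp_add]; congr 1; ring
  have e3 : (1 - (j N : ℝ)/N) = (N - j N)/N := by field_simp
  rw [e1, e2, hs2, hcast, e3]
  have hne : (N:ℝ) - j N ≠ 0 := by nlinarith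
  have hne2 := (Real.exp_pos (-(Real.pi * Real.sqrt N))).ne'
  have hne3 := (Real.exp_pos (-(Real.pi * (Real.sqrt N * R)))).ne'
  generalize Real.exp (-(Real.pi * Real.sqrt N)) = X at *
  generalize Real.exp (-(Real.pi * (Real.sqrt N * R))) = Y at *
  field_simp

lemma H_lim (m : ℕ → ℕ) (x : ℝ) (hx : 0 < x) (hm : Tendsto (fun N : ℕ => (m N : ℝ) / Real.sqrt N) atTop (nhds x)) :
    Tendsto (fun N : ℕ => H (m N) N / 2 / oc N) atTop (nhds (1 / (1 + Real.exp (Real.pi * x / 2)))) := by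
  obtain ⟨C, hC, hb⟩ := oz_bound
  set ρ := Real.exp (-(Real.pi * x / 2)) with hρ
  have hρ0 : 0 < ρ := Real.exp_pos _
  have hρ1 : ρ < 1 := by
    rw [hρ, Real.exp_lt_one_iff]; have := Real.pi_pos; nlinarith [mul_pos Real.pi_pos hx]
  have hg : HasSum (fun k : ℕ => (-1:ℝ)^k * ρ^(k+1)) (1 / (1 + Real.exp (Real.pi * x / 2))) := by
    have h := (hasSum_geometric_of_abs_lt_one (r := -ρ) (by rw [abs_neg, abs_of_pos hρ0]; exact hρ1)).mul_left ρ
    have e : ρ * (1 - -ρ)⁻¹ = 1 / (1 + Real.exp (Real.pi * x / 2)) := by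
      have : Real.exp (Real.pi * x / 2) = ρ⁻¹ := by rw [hρ, ← Real.exp_neg, neg_neg]
      have h0 : 1 + ρ ≠ 0 := by positivity
      rw [this, sub_neg_eq_add]; field_simp
      ring
    rw [e] at h
    have e2 : (fun k : ℕ => (-1:ℝ)^k * ρ^(k+1)) = (fun i => ρ * (-ρ)^i) := by
      funext k; rw [neg_pow]; ring
    rw [e2]; exact h
  rw [← hg.tsum_eq]
  set τ := Real.exp (-(Real.pi/8*x)) with hτ
  have hτ1 : τ < 1 := by
    rw [hτ, Real.exp_lt_one_iff]; nlinarith [mul_pos Real.pi_pos hx]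
  have hT := tendsto_tsum_of_dominated_convergence (𝓕 := atTop)
    (f := fun (N : ℕ) (k : ℕ) => (-1:ℝ)^k * oz N ((k+1)*(k+1) + (k+1) * m N) / oc N)
    (g := fun k : ℕ => (-1:ℝ)^k * ρ^(k+1))
    (bound := fun k => C * τ^k)
    ((summable_geometric_of_lt_one (Real.exp_pos _).le hτ1).mul_left C) ?_ ?_
  · refine hT.congr' ?_
    filter_upwards [eventually_gt_atTop 0] with N hN
    exact ((H_hasSum (m N) N hN).div_const (oc N : ℝ)).tsum_eq
  · intro k
    have h1 := oz_lim (fun N => (k+1)*(k+1) + (k+1) * m N) ((k+1)*x) (by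
      have h2 : Tendsto (fun N : ℕ => ((k:ℝ)+1)*(k+1) / Real.sqrt N) atTop (nhds 0) :=
        tendsto_const_nhds.div_atTop sqrt_nat_tendsto
      have h3 := h2.add (hm.const_mul ((k:ℝ)+1))
      rw [zero_add] at h3
      refine h3.congr (fun N => ?_)
      push_cast; ring)
    have h2 := h1.const_mul ((-1:ℝ)^k)
    have e : Real.exp (-(Real.pi * ((k+1)*x) / 2)) = ρ^(k+1) := by
      rw [hρ, ← Real.exp_nat_mul]; congr 1; push_cast; ring
    rw [e] at h2
    refine h2.congr (fun N => ?_)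
    ring
  · filter_upwards [hb, oc_pos_ev, hm.eventually_const_le (by linarith : x/2 < x), eventually_gt_atTop 0] with N h1 h2 h3 h4 k
    have hN' : (0:ℝ) < N := by exact_mod_cast h4
    have hs : 0 < Real.sqrt N := Real.sqrt_pos.2 hN'
    rw [norm_div, norm_mul, norm_pow, norm_neg, norm_one, one_pow, one_mul, Real.norm_eq_abs,
      Real.norm_eq_abs, abs_of_pos h2, abs_of_nonneg (oz_nonneg _ _), div_le_iff₀ h2]
    refine (h1 _).trans ?_
    rw [mul_right_comm]
    apply mul_le_mul_of_nonneg_right _ h2.le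
    apply mul_le_mul_of_nonneg_left _ hC.le
    rw [hτ, ← Real.exp_nat_mul]
    apply Real.exp_le_exp.2
    have h5 : (k:ℝ) * (x/2) ≤ (((k+1)*(k+1) + (k+1) * m N : ℕ) : ℝ) / Real.sqrt N := by
      have hk : (0:ℝ) ≤ k := Nat.cast_nonneg k
      calc (k:ℝ) * (x/2) ≤ k * ((m N : ℝ) / Real.sqrt N) := by gcongr
        _ = (k * m N) / Real.sqrt N := by ring
        _ ≤ _ := by
          apply div_le_div_of_nonneg_right _ hs.le
          push_cast
          have : (0:ℝ) ≤ m N := Nat.cast_nonneg _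
          nlinarith
    have := Real.pi_pos
    nlinarith

lemma G_lim (x : ℝ) (hx : 0 < x) :
    Tendsto (fun N : ℕ => (G ⌈Real.sqrt N * x⌉₊ N : ℝ) / oc N) atTop (nhds (1 / (1 + Real.exp (Real.pi * x / 2)))) := by
  have hup : Tendsto (fun N : ℕ => ((⌈Real.sqrt N * x⌉₊ : ℕ) : ℝ) / Real.sqrt N) atTop (nhds x) := by
    have h1 : Tendsto (fun N : ℕ => x + 1 / Real.sqrt N) atTop (nhds x) := by
      simpa using (tendsto_const_nhds.div_atTop sqrt_nat_tendsto (a := (1:ℝ))).const_add x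
    refine tendsto_of_tendsto_of_tendsto_of_le_of_le' tendsto_const_nhds h1 ?_ ?_
    · filter_upwards [sqrt_nat_tendsto.eventually_gt_atTop 0] with N hs
      rw [le_div_iff₀ hs, mul_comm]; exact Nat.le_ceil _
    · filter_upwards [sqrt_nat_tendsto.eventually_gt_atTop 0] with N hs
      rw [div_le_iff₀ hs, add_mul, one_div_mul_cancel hs.ne', mul_comm x]
      exact (Nat.ceil_lt_add_one (by positivity)).le
  have hpos : ∀ᶠ N : ℕ in atTop, 1 ≤ ⌈Real.sqrt N * x⌉₊ := by
    filter_upwards [sqrt_nat_tendsto.eventually_gt_atTop 0] with N hs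
    exact Nat.one_le_ceil_iff.2 (by positivity)
  have hdn : Tendsto (fun N : ℕ => ((⌈Real.sqrt N * x⌉₊ - 1 : ℕ) : ℝ) / Real.sqrt N) atTop (nhds x) := by
    have h2 := hup.sub (tendsto_const_nhds.div_atTop sqrt_nat_tendsto (a := (1:ℝ)))
    rw [sub_zero] at h2
    refine h2.congr' ?_
    filter_upwards [hpos] with N h1
    rw [Nat.cast_sub h1]; push_cast; ring
  refine tendsto_of_tendsto_of_tendsto_of_le_of_le' (H_lim _ x hx hup) (H_lim _ x hx hdn) ?_ ?_
  · filter_upwards [oc_pos_ev] with N h1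
    apply div_le_div_of_nonneg_right _ h1.le
    unfold H
    have : (G (⌈Real.sqrt N * x⌉₊ + 1) N : ℝ) ≤ G ⌈Real.sqrt N * x⌉₊ N := by exact_mod_cast G_anti _ _
    linarith
  · filter_upwards [oc_pos_ev, hpos] with N h1 h2
    apply div_le_div_of_nonneg_right _ h1.le
    obtain ⟨k, hk⟩ := Nat.exists_eq_add_of_le' h2
    rw [hk, Nat.add_sub_cancel]
    unfold H
    have : (G (k+1) N : ℝ) ≤ G k N := by exact_mod_cast G_anti _ _
    linarith

lemma G_bound : ∃ C : ℝ, 0 < C ∧ ∀ᶠ N : ℕ in atTop, ∀ x : ℝ, 0 < x →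
    (G ⌈Real.sqrt N * x⌉₊ N : ℝ) / oc N ≤ C * Real.exp (-(Real.pi/4) * x) := by
  obtain ⟨C, hC, hb⟩ := oz_bound
  refine ⟨2*C, by positivity, ?_⟩
  filter_upwards [hb, oc_pos_ev, sqrt_nat_tendsto.eventually_gt_atTop 0, eventually_gt_atTop 0] with N h1 h2 hs h0 x hx
  rw [div_le_iff₀ h2]
  have h3 := H_le ⌈Real.sqrt N * x⌉₊ N h0
  have h4 := h1 (⌈Real.sqrt N * x⌉₊ + 1)
  have h5 : (G ⌈Real.sqrt N * x⌉₊ N : ℝ) ≤ H ⌈Real.sqrt N * x⌉₊ N := by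
    unfold H; have : (0:ℝ) ≤ G (⌈Real.sqrt N * x⌉₊ + 1) N := Nat.cast_nonneg _
    linarith
  have h6 : x ≤ ((⌈Real.sqrt N * x⌉₊ + 1 : ℕ) : ℝ) / Real.sqrt N := by
    rw [le_div_iff₀ hs]; push_cast
    have := Nat.le_ceil (Real.sqrt N * x)
    linarith
  have h7 : Real.exp (-(Real.pi/4) * (((⌈Real.sqrt N * x⌉₊ + 1 : ℕ) : ℝ) / Real.sqrt N)) ≤ Real.exp (-(Real.pi/4) * x) := by
    apply Real.exp_le_exp.2
    have := Real.pi_pos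
    nlinarith
  calc (G ⌈Real.sqrt N * x⌉₊ N : ℝ) ≤ 2 * (C * oc N * Real.exp (-(Real.pi/4) * (((⌈Real.sqrt N * x⌉₊ + 1 : ℕ) : ℝ) / Real.sqrt N))) := by linarith
    _ ≤ 2 * (C * oc N * Real.exp (-(Real.pi/4) * x)) := by gcongr
    _ = _ := by ring
end RankAux

open scoped BigOperators
open Filter MeasureTheory
namespace RankAux

lemma zeta_real (r : ℕ) (hr : 2 ≤ r) :
    HasSum (fun k : ℕ => 1 / ((k:ℝ) + 1)^r) (riemannZeta r).re := by
  have h1 : Summable (fun n : ℕ => 1 / (n:ℝ)^r) := Real.summable_one_div_nat_pow.2 (by omega)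
  have h2 : riemannZeta r = ((∑' n : ℕ, 1 / (n:ℝ)^r : ℝ) : ℂ) := by
    rw [zeta_nat_eq_tsum_of_gt_one (by omega)]
    push_cast
    rfl
  have h3 : (riemannZeta r).re = ∑' n : ℕ, 1 / (n:ℝ)^r := by rw [h2, Complex.ofReal_re]
  have h4 := (hasSum_nat_add_iff' (f := fun n : ℕ => 1 / (n:ℝ)^r) 1).2 h1.hasSum
  rw [h3]
  have h5 : (∑ i ∈ Finset.range 1, 1 / ((i:ℕ):ℝ)^r) = 0 := by
    simp; omega
  rw [h5, sub_zero] at h4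
  have e : (fun k : ℕ => 1 / ((k:ℝ) + 1)^r) = fun n : ℕ => 1 / ((n + 1 : ℕ) : ℝ)^r := by
    funext k; push_cast; rfl
  rw [e]; exact h4

lemma eta_pos (r : ℕ) (hr : 1 ≤ r) : 0 < dirichletEtaNat r := by
  unfold dirichletEtaNat
  split_ifs with h
  · exact Real.log_pos (by norm_num)
  · have hr2 : 2 ≤ r := by omega
    refine mul_pos ?_ ?_
    · have : (2:ℝ) ^ (1 - (r:ℝ)) < 1 := by
        apply Real.rpow_lt_one_of_one_lt_of_neg (by norm_num)
        have : (2:ℝ) ≤ r := by exact_mod_cast hr2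
        linarith
      linarith
    · have hs := zeta_real r hr2
      have := hs.summable.tsum_pos (fun k => by positivity) 0 (by positivity)
      rwa [hs.tsum_eq] at this

lemma eta_hasSum (r : ℕ) (hr : 2 ≤ r) :
    HasSum (fun k : ℕ => (-1:ℝ)^k / ((k:ℝ) + 1)^r) (dirichletEtaNat r) := by
  have hz := zeta_real r hr
  set Z := (riemannZeta r).re
  have hod : HasSum (fun k : ℕ => (1 - (-1:ℝ)^k) / ((k:ℝ)+1)^r) (0 + 2 / 2^r * Z) := by
    refine HasSum.even_add_odd ?_ ?_
    · have e : (fun k : ℕ => (1 - (-1:ℝ)^(2*k)) / (((2*k : ℕ):ℝ)+1)^r) = fun _ => 0 := by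
        funext k; rw [pow_mul]; simp
      rw [e]; exact hasSum_zero
    · have e : (fun k : ℕ => (1 - (-1:ℝ)^(2*k+1)) / (((2*k+1 : ℕ):ℝ)+1)^r)
          = fun k : ℕ => 2 / 2^r * (1 / ((k:ℝ)+1)^r) := by
        funext k
        rw [pow_succ, pow_mul]
        push_cast
        rw [show 2 * (k:ℝ) + 1 + 1 = 2 * (k+1) by ring, mul_pow]
        have : ((k:ℝ)+1)^r ≠ 0 := by positivity
        field_simp
        norm_num
      rw [e]; exact hz.mul_left _
  have h := hz.sub hod
  have e : (fun k : ℕ => (-1:ℝ)^k / ((k:ℝ) + 1)^r)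
      = fun k : ℕ => 1 / ((k:ℝ) + 1)^r - (1 - (-1:ℝ)^k) / ((k:ℝ)+1)^r := by
    funext k; ring
  rw [e]
  have e2 : dirichletEtaNat r = Z - (0 + 2 / 2^r * Z) := by
    unfold dirichletEtaNat
    rw [if_neg (by omega), Real.rpow_sub (by norm_num), Real.rpow_one, Real.rpow_natCast]
    ring
  rw [e2]; exact h

lemma int_pow_exp (r : ℕ) (hr : 1 ≤ r) (c : ℝ) (hc : 0 < c) :
    IntegrableOn (fun x : ℝ => x^(r-1) * Real.exp (-(c*x))) (Set.Ioi 0) ∧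
    ∫ x in Set.Ioi (0:ℝ), x^(r-1) * Real.exp (-(c*x)) = (r-1).factorial / c^r := by
  have hr' : (0:ℝ) < r := by exact_mod_cast hr
  have h1 : ∫ x in Set.Ioi (0:ℝ), x^(r-1) * Real.exp (-(c*x)) = (r-1).factorial / c^r := by
    have h := Real.integral_rpow_mul_exp_neg_mul_Ioi hr' hc
    rw [show ((r:ℝ) - 1) = ((r-1 : ℕ) : ℝ) by rw [Nat.cast_sub hr]; simp] at h
    simp only [Real.rpow_natCast] at h
    rw [h]
    have hg : Real.Gamma (r:ℝ) = (r-1).factorial := by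
      have := Real.Gamma_nat_eq_factorial (r-1)
      rw [← this]; congr 1; rw [Nat.cast_sub hr]; simp
    rw [hg, one_div, inv_pow]; ring
  refine ⟨?_, h1⟩
  by_contra hni
  have h2 := integral_undef hni
  rw [h1] at h2
  have : (0:ℝ) < (r-1).factorial / c^r := by positivity
  linarith

lemma fermi_one (a : ℝ) (ha : 0 < a) :
    ∫ x in Set.Ioi (0:ℝ), 1 / (1 + Real.exp (a*x)) = Real.log 2 / a := by
  have hd : ∀ x : ℝ, HasDerivAt (fun x => -(1/a) * Real.log (1 + Real.exp (-(a*x))))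
      (1 / (1 + Real.exp (a*x))) x := by
    intro x
    have h1 : HasDerivAt (fun x : ℝ => -(a*x)) (-(a*1)) x := ((hasDerivAt_id x).const_mul a).neg
    have h2 := (h1.exp.const_add 1).log (by positivity)
    refine (h2.const_mul (-(1/a))).congr_deriv ?_
    rw [Real.exp_neg]
    have := Real.exp_pos (a*x)
    field_simp
    ring
  have hl : Tendsto (fun x => -(1/a) * Real.log (1 + Real.exp (-(a*x)))) atTop (nhds 0) := by
    have h1 : Tendsto (fun x : ℝ => Real.exp (-(a*x))) atTop (nhds 0) :=
      Real.tendsto_exp_neg_atTop_nhds_zero.comp (tendsto_id.const_mul_atTop ha)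
    have h2 := ((h1.const_add 1).log (by norm_num)).const_mul (-(1/a))
    simpa using h2
  rw [integral_Ioi_of_hasDerivAt_of_nonneg (hd 0).continuousAt.continuousWithinAt
    (fun x _ => hd x) (fun x _ => by positivity) hl]
  norm_num
  ring

lemma fermi (r : ℕ) (hr : 1 ≤ r) (a : ℝ) (ha : 0 < a) :
    ∫ x in Set.Ioi (0:ℝ), (r:ℝ) * x^(r-1) * (1 / (1 + Real.exp (a*x)))
      = r.factorial * dirichletEtaNat r / a^r := by
  rcases Nat.lt_or_ge r 2 with h | h
  · have : r = 1 := by omega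
    subst this
    have := fermi_one a ha
    simp only [Nat.cast_one, Nat.sub_self, pow_zero, one_mul, Nat.factorial, dirichletEtaNat, if_true, pow_one]
    rw [this]; simp
  have hI : ∀ k : ℕ, IntegrableOn (fun x : ℝ => (r:ℝ) * (-1)^k * (x^(r-1) * Real.exp (-((k+1)*a*x)))) (Set.Ioi 0) :=
    fun k => (int_pow_exp r hr ((k+1)*a) (by positivity)).1.const_mul _
  have hv : ∀ k : ℕ, ∫ x in Set.Ioi (0:ℝ), (r:ℝ) * (-1)^k * (x^(r-1) * Real.exp (-((k+1)*a*x)))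
      = r.factorial / a^r * ((-1)^k / ((k:ℝ)+1)^r) := by
    intro k
    rw [integral_const_mul, (int_pow_exp r hr ((k+1)*a) (by positivity)).2, mul_pow]
    have : (r.factorial : ℝ) = r * (r-1).factorial := by
      exact_mod_cast (Nat.mul_factorial_pred (by omega)).symm
    rw [this]
    field_simp
  have hn : ∀ k : ℕ, ∫ x in Set.Ioi (0:ℝ), ‖(r:ℝ) * (-1)^k * (x^(r-1) * Real.exp (-((k+1)*a*x)))‖
      = r.factorial / a^r * (1 / ((k:ℝ)+1)^r) := by
    intro k
    have e : ∫ x in Set.Ioi (0:ℝ), ‖(r:ℝ) * (-1)^k * (x^(r-1) * Real.exp (-((k+1)*a*x)))‖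
      = ∫ x in Set.Ioi (0:ℝ), (r:ℝ) * (x^(r-1) * Real.exp (-((k+1)*a*x))) := by
      refine setIntegral_congr_fun measurableSet_Ioi (fun x hx => ?_)
      have hx' : (0:ℝ) < x := hx
      simp only [norm_mul, norm_pow, norm_neg, norm_one, one_pow, mul_one, Real.norm_eq_abs, Nat.abs_cast,
        Real.abs_exp, abs_of_pos hx']
    rw [e, integral_const_mul, (int_pow_exp r hr ((k+1)*a) (by positivity)).2, mul_pow]
    have : (r.factorial : ℝ) = r * (r-1).factorial := by
      exact_mod_cast (Nat.mul_factorial_pred (by omega)).symm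
    rw [this]
    field_simp
  have hS := hasSum_integral_of_summable_integral_norm (μ := volume.restrict (Set.Ioi (0:ℝ))) hI (by
    simp only [hn]
    exact (zeta_real r h).summable.mul_left _)
  simp only [hv] at hS
  have hS2 := ((eta_hasSum r h).mul_left ((r.factorial:ℝ) / a^r)).unique hS
  have e : ∫ x in Set.Ioi (0:ℝ), (r:ℝ) * x^(r-1) * (1 / (1 + Real.exp (a*x)))
      = ∫ x in Set.Ioi (0:ℝ), ∑' k : ℕ, (r:ℝ) * (-1)^k * (x^(r-1) * Real.exp (-((k+1)*a*x))) := by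
    refine setIntegral_congr_fun measurableSet_Ioi (fun x hx => ?_)
    have hx' : (0:ℝ) < x := hx
    set ρ := Real.exp (-(a*x)) with hρ
    have hρ0 : 0 < ρ := Real.exp_pos _
    have hρ1 : ρ < 1 := by
      rw [hρ, Real.exp_lt_one_iff]; nlinarith [mul_pos ha hx']
    have hg := (hasSum_geometric_of_abs_lt_one (r := -ρ) (by rw [abs_neg, abs_of_pos hρ0]; exact hρ1)).mul_left ((r:ℝ) * x^(r-1) * ρ)
    have e2 : (fun k : ℕ => (r:ℝ) * (-1)^k * (x^(r-1) * Real.exp (-((k+1)*a*x)))) = fun k : ℕ => (r:ℝ) * x^(r-1) * ρ * (-ρ)^k := by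
      funext k
      rw [show -(((k:ℝ)+1)*a*x) = ((k+1 : ℕ):ℝ) * (-(a*x)) by push_cast; ring, Real.exp_nat_mul, neg_pow, ← hρ]
      ring
    have e3 : Real.exp (a*x) = ρ⁻¹ := by rw [hρ, ← Real.exp_neg, neg_neg]
    have h0 : 1 + ρ ≠ 0 := by positivity
    show (r:ℝ) * x^(r-1) * (1 / (1 + Real.exp (a*x))) = ∑' k : ℕ, (r:ℝ) * (-1)^k * (x^(r-1) * Real.exp (-((k+1)*a*x)))
    rw [e2, hg.tsum_eq, e3, sub_neg_eq_add]
    field_simp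
    ring
  rw [e, ← hS2]; ring

lemma Nplus_int (r N : ℕ) (hr : 1 ≤ r) (hN : 0 < N) :
    Nplus r N = ∫ y in Set.Ioi (0:ℝ), (r:ℝ) * y^(r-1) * (G ⌈y⌉₊ N : ℝ) := by
  set φ : ℝ → ℝ := fun y => (r:ℝ) * y^(r-1) * (G ⌈y⌉₊ N : ℝ) with hφ
  have hcong : ∀ m : ℕ, Set.EqOn φ (fun y => (r:ℝ) * y^(r-1) * (G (m+1) N : ℝ)) (Set.Ioc (m:ℝ) ((m+1 : ℕ):ℝ)) := by
    intro m y hy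
    have : ⌈y⌉₊ = m + 1 := by
      rw [Nat.ceil_eq_iff (by omega)]
      exact ⟨by simpa using hy.1, hy.2⟩
    simp only [hφ, this]
  have hle : ∀ m : ℕ, (m:ℝ) ≤ ((m+1 : ℕ):ℝ) := fun m => by push_cast; linarith
  have hcint : ∀ m : ℕ, IntervalIntegrable (fun y : ℝ => (r:ℝ) * y^(r-1) * (G (m+1) N : ℝ)) volume (m:ℝ) ((m+1 : ℕ):ℝ) :=
    fun m => (by fun_prop : Continuous (fun y : ℝ => (r:ℝ) * y^(r-1) * (G (m+1) N : ℝ))).intervalIntegrable _ _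
  have hIntv : ∀ m : ℕ, IntervalIntegrable φ volume (m:ℝ) ((m+1 : ℕ):ℝ) := by
    intro m
    refine (hcint m).congr ?_
    rw [Set.uIoc_of_le (hle m)]
    exact (hcong m).symm
  have hval : ∀ m : ℕ, ∫ y in (m:ℝ)..((m+1 : ℕ):ℝ), φ y = (((m:ℝ)+1)^r - (m:ℝ)^r) * G (m+1) N := by
    intro m
    rw [intervalIntegral.integral_of_le (hle m), setIntegral_congr_fun measurableSet_Ioc (hcong m),
      ← intervalIntegral.integral_of_le (hle m), intervalIntegral.integral_mul_const,
      intervalIntegral.integral_const_mul, integral_pow]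
    have e : r - 1 + 1 = r := by omega
    have e' : ((r-1 : ℕ):ℝ) + 1 = r := by exact_mod_cast e
    have hr0 : (r:ℝ) ≠ 0 := by positivity
    rw [e, e']; push_cast
    field_simp
  have hsum := intervalIntegral.sum_integral_adjacent_intervals (f := φ) (μ := volume) (a := fun k : ℕ => (k:ℝ)) (n := N)
    (fun k _ => hIntv k)
  have hIoi : ∫ y in Set.Ioi (0:ℝ), φ y = ∫ y in Set.Ioc (0:ℝ) N, φ y := by
    refine setIntegral_eq_of_subset_of_forall_sdiff_eq_zero measurableSet_Ioi Set.Ioc_subset_Ioi_self ?_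
    intro y hy
    have hy1 : (0:ℝ) < y := hy.1
    have hy2 : (N:ℝ) < y := by
      by_contra hc
      exact hy.2 ⟨hy1, not_lt.1 hc⟩
    have : N ≤ ⌈y⌉₊ := by
      have := Nat.le_ceil y
      exact_mod_cast (hy2.le.trans this)
    simp only [hφ, G_zero_of_le _ _ hN this, Nat.cast_zero, mul_zero]
  rw [hIoi, ← intervalIntegral.integral_of_le (Nat.cast_nonneg N), Nplus_eq r N hr hN]
  simp only [Nat.cast_zero] at hsum
  rw [← hsum]
  exact Finset.sum_congr rfl (fun m _ => (hval m).symm)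

lemma Nplus_scaled (r N : ℕ) (hr : 1 ≤ r) (hN : 0 < N) :
    Nplus r N / (Real.sqrt N)^r / oc N
      = ∫ x in Set.Ioi (0:ℝ), (r:ℝ) * x^(r-1) * ((G ⌈Real.sqrt N * x⌉₊ N : ℝ) / oc N) := by
  have hs : 0 < Real.sqrt N := Real.sqrt_pos.2 (by exact_mod_cast hN)
  have h := integral_comp_mul_left_Ioi (fun y => (r:ℝ) * y^(r-1) * (G ⌈y⌉₊ N : ℝ)) 0 hs
  rw [mul_zero, ← Nplus_int r N hr hN, smul_eq_mul] at h
  have e : (fun x : ℝ => (r:ℝ) * x^(r-1) * ((G ⌈Real.sqrt N * x⌉₊ N : ℝ) / oc N))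
      = fun x : ℝ => (1 / (Real.sqrt N)^(r-1) / oc N) * ((r:ℝ) * (Real.sqrt N * x)^(r-1) * (G ⌈Real.sqrt N * x⌉₊ N : ℝ)) := by
    funext x
    rw [mul_pow]
    have : (Real.sqrt N)^(r-1) ≠ 0 := by positivity
    field_simp
  rw [e, integral_const_mul, h]
  have e2 : (Real.sqrt N)^r = (Real.sqrt N)^(r-1) * Real.sqrt N := by
    rw [← pow_succ]; congr 1; omega
  rw [e2]
  field_simp

lemma Nplus_lim (r : ℕ) (hr : 1 ≤ r) :
    Tendsto (fun N : ℕ => Nplus r N / (Real.sqrt N)^r / oc N) atTop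
      (nhds (r.factorial * dirichletEtaNat r / (Real.pi/2)^r)) := by
  obtain ⟨C, hC, hb⟩ := G_bound
  rw [← fermi r hr (Real.pi/2) (by positivity)]
  have hT : Tendsto (fun N : ℕ => ∫ x in Set.Ioi (0:ℝ), (r:ℝ) * x^(r-1) * ((G ⌈Real.sqrt N * x⌉₊ N : ℝ) / oc N)) atTop
      (nhds (∫ x in Set.Ioi (0:ℝ), (r:ℝ) * x^(r-1) * (1 / (1 + Real.exp (Real.pi/2*x))))) := by
    refine tendsto_integral_filter_of_dominated_convergence
      (fun x => (r:ℝ) * C * (x^(r-1) * Real.exp (-(Real.pi/4*x)))) ?_ ?_ ?_ ?_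
    · refine Eventually.of_forall (fun N => ?_)
      have hm : Measurable (fun x : ℝ => ((G ⌈Real.sqrt N * x⌉₊ N : ℝ))) := by
        have h1 : Measurable (fun x : ℝ => ⌈Real.sqrt N * x⌉₊) :=
          Nat.measurable_ceil.comp (measurable_const.mul measurable_id)
        exact (measurable_from_nat (f := fun m => (G m N : ℝ))).comp h1
      exact (((measurable_id.pow_const (r-1)).const_mul (r:ℝ)).mul (hm.div_const _)).aestronglyMeasurable
    · filter_upwards [hb] with N hN
      refine (ae_restrict_iff' measurableSet_Ioi).2 (Eventually.of_forall (fun x hx => ?_))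
      have hx' : (0:ℝ) < x := hx
      rw [Real.norm_of_nonneg (by positivity)]
      have := hN x hx'
      rw [show -(Real.pi/4) * x = -(Real.pi/4*x) by ring] at this
      calc _ ≤ (r:ℝ) * x^(r-1) * (C * Real.exp (-(Real.pi/4*x))) := by gcongr
        _ = _ := by ring
    · exact (int_pow_exp r hr (Real.pi/4) (by positivity)).1.const_mul _
    · refine (ae_restrict_iff' measurableSet_Ioi).2 (Eventually.of_forall (fun x hx => ?_))
      have := (G_lim x hx).const_mul ((r:ℝ) * x^(r-1))
      rw [show Real.pi * x / 2 = Real.pi/2*x by ring] at this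
      exact this
  refine hT.congr' ?_
  filter_upwards [eventually_gt_atTop 0] with N hN
  exact (Nplus_scaled r N hr hN).symm

end RankAux

theorem positive_rank_moment_asymptotic (r : ℕ) (hr : 1 ≤ r) :
    Filter.Tendsto
      (fun N : ℕ => Nplus r N /
        (((r.factorial : ℝ) * dirichletEtaNat r * Real.pi ^ (-(r : ℝ)) * 2 ^ ((r : ℝ) - 3)) *
          (N : ℝ) ^ ((r : ℝ) / 2 - 1) * Real.exp (Real.pi * Real.sqrt N)))
      Filter.atTop (nhds 1) := by
  have hη := RankAux.eta_pos r hr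
  have h := ((RankAux.Nplus_lim r hr).mul RankAux.oc_asymp).div_const
    ((r.factorial : ℝ) * dirichletEtaNat r * Real.pi ^ (-(r : ℝ)) * 2 ^ ((r : ℝ) - 3))
  have hf : (0:ℝ) < r.factorial := by positivity
  have hγ : (r.factorial : ℝ) * dirichletEtaNat r * Real.pi ^ (-(r : ℝ)) * 2 ^ ((r : ℝ) - 3)
      = r.factorial * dirichletEtaNat r / (Real.pi/2)^r * (1/8) := by
    rw [Real.rpow_neg Real.pi_pos.le, Real.rpow_natCast, Real.rpow_sub (by norm_num), Real.rpow_natCast, div_pow]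
    have e8 : (2:ℝ)^(3:ℝ) = 8 := by
      rw [show (3:ℝ) = ((3:ℕ):ℝ) by norm_num, Real.rpow_natCast]; norm_num
    rw [e8]
    field_simp
  have hγ0 : 0 < (r.factorial : ℝ) * dirichletEtaNat r * Real.pi ^ (-(r : ℝ)) * 2 ^ ((r : ℝ) - 3) := by
    positivity
  rw [← hγ, div_self hγ0.ne'] at h
  refine h.congr' ?_
  filter_upwards [Filter.eventually_gt_atTop 0, RankAux.oc_pos_ev] with N hN hpos
  generalize (r.factorial : ℝ) * dirichletEtaNat r * Real.pi ^ (-(r : ℝ)) * 2 ^ ((r : ℝ) - 3) = γ at *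
  have hN' : (0:ℝ) < N := by exact_mod_cast hN
  have e1 : (N:ℝ) ^ ((r : ℝ) / 2 - 1) = (Real.sqrt N)^r / N := by
    rw [Real.rpow_sub hN', Real.rpow_one, Real.sqrt_eq_rpow, ← Real.rpow_natCast, ← Real.rpow_mul hN'.le]
    congr 2; ring
  have hs : 0 < Real.sqrt N := Real.sqrt_pos.2 hN'
  rw [e1, Real.exp_neg]
  have hE := Real.exp_pos (Real.pi * Real.sqrt N)
  generalize Real.exp (Real.pi * Real.sqrt N) = E at *
  have hsr : 0 < (Real.sqrt N)^r := by positivity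
  generalize (Real.sqrt N)^r = S at *
  field_simp
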